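/- Let H be a separable infinite-dimensional complex Hilbert space and T a bounded operator on H. Then the closure of the unitary orbit U(T) in the strong operator topology equals the set of all bounded operators B on H such that B is unitarily equivalent to the restriction, to a closed invariant subspace, of some operator in the norm closure of U(T). -/

import Mathlib

open Filter Topology ContinuousLinearMap

/-- Conjugation of an operator by a unitary (linear isometric equivalence): `W T W*`. -/
noncomputable def conjOp {H₁ H₂ : Type*} [NormedAddCommGroup H₁] [InnerProductSpace ℂ H₁]
    [NormedAddCommGroup H₂] [InnerProductSpace ℂ H₂]
    (W : H₁ ≃ₗᵢ[ℂ] H₂) (T : H₁ →L[ℂ] H₁) : H₂ →L[ℂ] H₂ :=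
  ((W.toContinuousLinearEquiv : H₁ →L[ℂ] H₂).comp T).comp
    ((W.symm.toContinuousLinearEquiv : H₂ →L[ℂ] H₁))

/-- The restriction of an operator to an invariant subspace. -/
noncomputable def opRestrict {H : Type*} [NormedAddCommGroup H] [InnerProductSpace ℂ H]
    (T : H →L[ℂ] H) (M : Submodule ℂ H) (hM : ∀ x ∈ M, T x ∈ M) : M →L[ℂ] M :=
  { toLinearMap := (T : H →ₗ[ℂ] H).restrict hM
    cont := Continuous.subtype_mk (T.continuous.comp continuous_subtype_val) _ }

/-- Two operators (possibly on different Hilbert spaces) are *compalent* if one is a compact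
perturbation of a unitary conjugate of the other: `T₂ = W T₁ W* + K` with `K` compact. -/
def Compalent {H₁ H₂ : Type*} [NormedAddCommGroup H₁] [InnerProductSpace ℂ H₁]
    [NormedAddCommGroup H₂] [InnerProductSpace ℂ H₂]
    (T₁ : H₁ →L[ℂ] H₁) (T₂ : H₂ →L[ℂ] H₂) : Prop :=
  ∃ W : H₁ ≃ₗᵢ[ℂ] H₂, IsCompactOperator (T₂ - conjOp W T₁)

/-- `S` is compalent to a reducing part of `T`, that is, to the restriction of `T` to a closed
subspace invariant under both `T` and `T*`. -/
def CompalentToReducingPart {H : Type*} [NormedAddCommGroup H] [InnerProductSpace ℂ H]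
    [CompleteSpace H] (S T : H →L[ℂ] H) : Prop :=
  ∃ (M : Submodule ℂ H) (_ : IsClosed (M : Set H))
    (hT : ∀ x ∈ M, T x ∈ M) (_ : ∀ x ∈ M, ContinuousLinearMap.adjoint T x ∈ M),
    Compalent S (opRestrict T M hT)

/-- The unitary orbit of `T`: all operators `W T W*` for unitaries `W`. -/
def unitaryOrbit {H : Type*} [NormedAddCommGroup H] [InnerProductSpace ℂ H]
    (T : H →L[ℂ] H) : Set (H →L[ℂ] H) :=
  {A | ∃ W : H ≃ₗᵢ[ℂ] H, A = conjOp W T}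

/-- The strong operator topology on `B(H)`: induced by the inclusion into `H → H` with the
topology of pointwise convergence. -/
noncomputable def sot (H : Type*) [NormedAddCommGroup H] [InnerProductSpace ℂ H] :
    TopologicalSpace (H →L[ℂ] H) :=
  TopologicalSpace.induced (fun T => (T : H → H)) Pi.topologicalSpace

/-- Closure in the strong operator topology. -/
noncomputable def sotClosure {H : Type*} [NormedAddCommGroup H] [InnerProductSpace ℂ H]
    (S : Set (H →L[ℂ] H)) : Set (H →L[ℂ] H) :=
  @closure _ (sot H) S

/-- `B` (an operator on `G`) is, up to unitary equivalence, the restriction of `A` to a closed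
invariant subspace. -/
def IsRestrictionOf {G H : Type*} [NormedAddCommGroup G] [InnerProductSpace ℂ G]
    [NormedAddCommGroup H] [InnerProductSpace ℂ H]
    (B : G →L[ℂ] G) (A : H →L[ℂ] H) : Prop :=
  ∃ (M : Submodule ℂ H) (_ : IsClosed (M : Set H)) (hinv : ∀ x ∈ M, A x ∈ M),
    ∃ W : G ≃ₗᵢ[ℂ] M, opRestrict A M hinv = conjOp W B


theorem ext_unitary {H : Type*} [NormedAddCommGroup H] [InnerProductSpace ℂ H]
    (V : H →ₗᵢ[ℂ] H) (F : Submodule ℂ H) [FiniteDimensional ℂ F] :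
    ∃ W : H ≃ₗᵢ[ℂ] H, ∀ x ∈ F, W x = V x := by
  classical
  let S : Submodule ℂ H := F ⊔ F.map V.toLinearMap
  have hFS : F ≤ S := le_sup_left
  have hVS : ∀ x ∈ F, V x ∈ S := fun x hx =>
    (le_sup_right : F.map V.toLinearMap ≤ S) (Submodule.mem_map_of_mem hx)
  have : FiniteDimensional ℂ S := inferInstance
  let F' : Submodule ℂ S := F.comap S.subtype
  let L : F' →ₗᵢ[ℂ] S :=
    { toFun := fun x => ⟨V (x : S), hVS _ x.2⟩
      map_add' := fun x y => by ext; simp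
      map_smul' := fun c x => by ext; simp
      norm_map' := fun x => by
        change ‖V ((x : S) : H)‖ = _
        rw [V.norm_map]; rfl }
  let E : S →ₗᵢ[ℂ] S := L.extend
  have hE : ∀ x (hx : x ∈ F), (E ⟨x, hFS hx⟩ : H) = V x := by
    intro x hx
    have := L.extend_apply ⟨⟨x, hFS hx⟩, hx⟩
    exact congrArg Subtype.val this
  have hEs : Function.Surjective E :=
    LinearMap.surjective_of_injective (f := E.toLinearMap) E.injective
  let P := S.orthogonalProjectionOnto
  let W0 : H →ₗ[ℂ] H :=
    (S.subtype ∘ₗ E.toLinearMap ∘ₗ (P : H →ₗ[ℂ] S)) + (LinearMap.id - S.subtype ∘ₗ (P : H →ₗ[ℂ] S))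
  have hW0 : ∀ x, W0 x = (E (P x) : H) + (x - (P x : H)) := fun x => rfl
  have hperp : ∀ x, x - (P x : H) ∈ Sᗮ := fun x => by
    exact S.sub_starProjection_mem_orthogonal x
  have hn : ∀ x, ‖W0 x‖ = ‖x‖ := by
    intro x
    have h1 : ‖W0 x‖ * ‖W0 x‖ = ‖x‖ * ‖x‖ := by
      rw [hW0, norm_add_sq_eq_norm_sq_add_norm_sq_of_inner_eq_zero (𝕜 := ℂ)]
      · have h2 : x = (P x : H) + (x - (P x : H)) := by abel
        conv_rhs => rw [h2]
        rw [norm_add_sq_eq_norm_sq_add_norm_sq_of_inner_eq_zero (𝕜 := ℂ)]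
        · have : ‖(E (P x) : H)‖ = ‖(P x : H)‖ := E.norm_map (P x)
          rw [this]
        · exact Submodule.inner_right_of_mem_orthogonal (P x).2 (hperp x)
      · exact Submodule.inner_right_of_mem_orthogonal (E (P x)).2 (hperp x)
    nlinarith [norm_nonneg (W0 x), norm_nonneg x, mul_self_inj (norm_nonneg (W0 x)) (norm_nonneg x)]
  let W1 : H →ₗᵢ[ℂ] H := ⟨W0, hn⟩
  have hPS : ∀ s : S, P (s : H) = s := fun s => S.orthogonalProjectionOnto_mem_subspace_eq_self s
  have hsurj : Function.Surjective W1 := by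
    intro y
    obtain ⟨s, hs⟩ := hEs (P y)
    refine ⟨(s : H) + (y - (P y : H)), ?_⟩
    have h3 : P ((s : H) + (y - (P y : H))) = s := by
      rw [map_add, map_sub, hPS, hPS]; simp
    change W0 _ = y
    rw [hW0, h3, hs]; abel
  refine ⟨LinearIsometryEquiv.ofSurjective W1 hsurj, fun x hx => ?_⟩
  change W0 x = V x
  have h4 : P x = ⟨x, hFS hx⟩ := hPS ⟨x, hFS hx⟩
  rw [hW0, h4, hE x hx]; simp

theorem mem_sotClosure_iff {H : Type*} [NormedAddCommGroup H] [InnerProductSpace ℂ H]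
    (s : Set (H →L[ℂ] H)) (B : H →L[ℂ] H) :
    B ∈ sotClosure s ↔ ∃ u : Ultrafilter (H →L[ℂ] H), s ∈ u ∧
      ∀ x, Tendsto (fun A : H →L[ℂ] H => A x) u (𝓝 (B x)) := by
  let _ := sot H
  unfold sotClosure
  rw [mem_closure_iff_ultrafilter]
  have : ∀ u : Ultrafilter (H →L[ℂ] H), ((u : Filter _) ≤ @nhds _ (sot H) B) ↔
      ∀ x, Tendsto (fun A : H →L[ℂ] H => A x) u (𝓝 (B x)) := by
    intro u
    rw [sot, nhds_induced, ← tendsto_iff_comap, tendsto_pi_nhds]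
  simp only [this]

theorem easy_dir {H : Type*} [NormedAddCommGroup H] [InnerProductSpace ℂ H]
    (T A B : H →L[ℂ] H) (hA : A ∈ closure (unitaryOrbit T)) (hB : IsRestrictionOf B A) :
    B ∈ sotClosure (unitaryOrbit T) := by
  obtain ⟨M, hM, hinv, W, hW⟩ := hB
  let V : H →ₗᵢ[ℂ] H := M.subtypeₗᵢ.comp W.toLinearIsometry
  have hV : ∀ x, A (V x) = V (B x) := by
    intro x
    have := congrArg (fun f => ((f (W x) : M) : H)) hW
    simp only [conjOp] at this
    have h2 : ((opRestrict A M hinv (W x) : M) : H) = A (V x) := rfl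
    rw [← h2, this]
    simp [V]
  unfold sotClosure
  refine (@mem_closure_iff_nhds _ (sot H) _ _).2 ?_
  intro t ht
  rw [sot, nhds_induced, mem_comap] at ht
  obtain ⟨t', ht', htt⟩ := ht
  rw [nhds_pi, Filter.mem_pi] at ht'
  obtain ⟨I, hI, U, hU, hUt⟩ := ht'
  -- finite subspace
  let F : Submodule ℂ H := Submodule.span ℂ (I ∪ (fun x => B x) '' I)
  have : FiniteDimensional ℂ F := FiniteDimensional.span_of_finite ℂ (hI.union (hI.image _))
  obtain ⟨Y, hY⟩ := ext_unitary V F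
  have hYA : ∀ x ∈ I, Y.symm (A (Y x)) = B x := by
    intro x hx
    rw [hY x (Submodule.subset_span (Or.inl hx)), hV,
      ← hY (B x) (Submodule.subset_span (Or.inr ⟨x, hx, rfl⟩))]
    simp
  have hc : ∀ᶠ A' in 𝓝 A, ∀ x ∈ I, Y.symm (A' (Y x)) ∈ U x := by
    rw [Filter.eventually_all_finite hI]
    intro x hx
    have hcont : Continuous fun A' : H →L[ℂ] H => Y.symm (A' (Y x)) :=
      Y.symm.continuous.comp (ContinuousLinearMap.apply ℂ H (Y x)).continuous
    have := hcont.tendsto A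
    rw [hYA x hx] at this
    exact this (hU x)
  obtain ⟨A', hA', Z, rfl⟩ := mem_closure_iff_nhds.1 hA _ hc
  refine ⟨conjOp (Z.trans Y.symm) T, htt (hUt ?_), ⟨_, rfl⟩⟩
  intro x hx
  have := hA' x hx
  simpa [conjOp] using this

theorem exists_partition (η : ℕ → ℝ) (hη : ∀ n, 0 < η n) :
    ∃ (c : ℕ → ℕ → ℝ) (N : ℕ → ℕ), (∀ n k, N n ≤ k → c n k = 0) ∧
      (∀ n k, |c n k - c n (k + 1)| ≤ η n) ∧ ∀ k, HasSum (fun n => c n k ^ 2) 1 := by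
  let δ : ℕ → ℝ := fun n => min (η n) (η (n + 1)) / 2
  have hδ : ∀ n, 0 < δ n := fun n => half_pos (lt_min (hη _) (hη _))
  have hδ1 : ∀ n, δ n ≤ η n / 2 := fun n =>
    div_le_div_of_nonneg_right (min_le_left _ _) (by norm_num)
  have hδ2 : ∀ n, δ n ≤ η (n + 1) / 2 := fun n =>
    div_le_div_of_nonneg_right (min_le_right _ _) (by norm_num)
  obtain ⟨A, hA⟩ : ∃ A : ℕ → ℕ, ∀ n, A (n + 1) = A n + (⌈Real.pi / 2 / δ n⌉₊ + 1) :=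
    ⟨fun n => Nat.rec (motive := fun _ => ℕ) 0 (fun n a => a + (⌈Real.pi / 2 / δ n⌉₊ + 1)) n,
      fun n => rfl⟩
  have hA1 : ∀ n : ℕ, (A n : ℝ) + Real.pi / 2 / δ n ≤ A (n + 1) := by
    intro n
    rw [hA]; push_cast
    have := Nat.le_ceil (Real.pi / 2 / δ n)
    linarith
  have hAn : ∀ n, n ≤ A n := by
    intro n
    induction n with
    | zero => simp
    | succ n ih => rw [hA]; omega
  let s : ℕ → ℕ → ℝ := fun n k => max 0 (min (((k : ℝ) - A n) * δ n) (Real.pi / 2))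
  have hpi := Real.pi_pos
  have hs0 : ∀ n k, k ≤ A n → s n k = 0 := by
    intro n k hk
    have : ((k : ℝ) - A n) * δ n ≤ 0 :=
      mul_nonpos_of_nonpos_of_nonneg (sub_nonpos.2 (by exact_mod_cast hk)) (hδ n).le
    exact max_eq_left ((min_le_left _ _).trans this)
  have hs1 : ∀ n k, A (n + 1) ≤ k → s n k = Real.pi / 2 := by
    intro n k hk
    have h1 : (A (n + 1) : ℝ) ≤ k := by exact_mod_cast hk
    have h2 : Real.pi / 2 ≤ ((k : ℝ) - A n) * δ n := by
      rw [← div_le_iff₀ (hδ n)]; linarith [hA1 n]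
    simp only [s, min_eq_right h2]
    exact max_eq_right (by positivity)
  have hsl : ∀ n k, |s n k - s n (k + 1)| ≤ δ n := by
    intro n k
    refine (abs_max_sub_max_le_max _ _ _ _).trans (max_le (by simp [(hδ n).le]) ?_)
    refine (abs_min_sub_min_le_max _ _ _ _).trans (max_le ?_ (by simp [(hδ n).le]))
    have : ((k : ℝ) - A n) * δ n - (((k + 1 : ℕ) : ℝ) - A n) * δ n = - δ n := by push_cast; ring
    rw [this, abs_neg, abs_of_pos (hδ n)]
  let p : ℕ → ℕ → ℝ := fun n k => Real.sin (s n k)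
  let q : ℕ → ℕ → ℝ := fun n k => Real.cos (s n k)
  have hpl : ∀ n k, |p n k - p n (k + 1)| ≤ δ n := fun n k => by
    have := Real.lipschitzWith_sin.dist_le_mul (s n k) (s n (k+1))
    rw [Real.dist_eq, Real.dist_eq] at this
    simpa using this.trans (by simpa using hsl n k)
  have hql : ∀ n k, |q n k - q n (k + 1)| ≤ δ n := fun n k => by
    have := Real.lipschitzWith_cos.dist_le_mul (s n k) (s n (k+1))
    rw [Real.dist_eq, Real.dist_eq] at this
    simpa using this.trans (by simpa using hsl n k)
  have hpq : ∀ n k, p n k ^ 2 + q n k ^ 2 = 1 := fun n k => Real.sin_sq_add_cos_sq _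
  have hp0 : ∀ n k, k ≤ A n → p n k = 0 := fun n k hk => by simp [p, hs0 n k hk]
  have hp1 : ∀ n k, A (n + 1) ≤ k → p n k = 1 := fun n k hk => by simp [p, hs1 n k hk]
  have hq0 : ∀ n k, A (n + 1) ≤ k → q n k = 0 := fun n k hk => by simp [q, hs1 n k hk]
  let c : ℕ → ℕ → ℝ := fun n k => Nat.casesOn n (q 0 k) (fun n => p n k * q (n + 1) k)
  have c0 : ∀ k, c 0 k = q 0 k := fun k => rfl
  have cs : ∀ n k, c (n + 1) k = p n k * q (n + 1) k := fun n k => rfl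
  refine ⟨c, fun n => A (n + 1), ?_, ?_, ?_⟩
  · intro n k hk
    cases n with
    | zero => rw [c0, hq0 0 k hk]
    | succ n => rw [cs, hq0 (n + 1) k hk, mul_zero]
  · intro n k
    cases n with
    | zero => rw [c0, c0]; linarith [hql 0 k, hδ1 0, hη 0]
    | succ n =>
      rw [cs, cs]
      have e : p n k * q (n + 1) k - p n (k + 1) * q (n + 1) (k + 1) =
        (p n k - p n (k + 1)) * q (n + 1) k + p n (k + 1) * (q (n + 1) k - q (n + 1) (k + 1)) := by
        ring
      rw [e]
      refine (abs_add_le _ _).trans ?_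
      rw [abs_mul, abs_mul]
      have h1 : |q (n + 1) k| ≤ 1 := Real.abs_cos_le_one _
      have h2 : |p n (k + 1)| ≤ 1 := Real.abs_sin_le_one _
      have h3 := mul_le_of_le_one_right (abs_nonneg (p n k - p n (k + 1))) h1
      have h4 := mul_le_of_le_one_left (abs_nonneg (q (n + 1) k - q (n + 1) (k + 1))) h2
      linarith [hpl n k, hql (n + 1) k, hδ2 n, hδ1 (n + 1)]
  · intro k
    have hsum : ∀ M, ∑ n ∈ Finset.range (M + 1), c n k ^ 2 = 1 - p M k ^ 2 := by
      intro M
      induction M with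
      | zero => simp [c0]; linarith [hpq 0 k]
      | succ M ih =>
        rw [Finset.sum_range_succ, ih, cs]
        rcases le_total k (A (M + 1)) with h | h
        · have := hpq (M + 1) k
          rw [hp0 (M + 1) k h] at this ⊢
          linear_combination (p M k ^ 2) * this
        · rw [hp1 M k h]
          linarith [hpq (M + 1) k]
    have h0 : 1 - p k k ^ 2 = 1 := by rw [hp0 k k (hAn k)]; norm_num
    rw [← h0, ← hsum k]
    apply hasSum_sum_of_ne_finset_zero
    intro n hn
    rw [Finset.mem_range, not_lt] at hn
    cases n with
    | zero => omega
    | succ n => rw [cs, hp0 n k ((by omega : k ≤ n).trans (hAn n))]; simp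

section filt
variable {K : Type*} [NormedAddCommGroup K] [InnerProductSpace ℂ K]

theorem filt_proj (F : ℕ → Submodule ℂ K) [∀ k, FiniteDimensional ℂ (F k)] (hF : Monotone F)
    (x : K) (k : ℕ) :
    ‖(F (k+1)).starProjection x‖ ^ 2 = ‖(F k).starProjection x‖ ^ 2 +
      ‖(F (k+1)).starProjection x - (F k).starProjection x‖ ^ 2 := by
  have h : (F k).starProjection ((F (k+1)).starProjection x) = (F k).starProjection x := by
    have := Submodule.starProjection_comp_starProjection_of_le (hF (Nat.le_succ k))
    exact congrArg (fun f => f x) this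
  have hp : inner ℂ ((F k).starProjection x)
      ((F (k+1)).starProjection x - (F k).starProjection x) = 0 := by
    have := (F k).sub_starProjection_mem_orthogonal ((F (k+1)).starProjection x)
    rw [h] at this
    exact Submodule.inner_right_of_mem_orthogonal (Submodule.starProjection_apply_mem _ x) this
  have := norm_add_sq_eq_norm_sq_add_norm_sq_of_inner_eq_zero _ _ hp
  rw [add_sub_cancel] at this
  nlinarith [this]

theorem filt_sum (F : ℕ → Submodule ℂ K) [∀ k, FiniteDimensional ℂ (F k)] (hF : Monotone F)
    (h0 : F 0 = ⊥) (x : K) (N : ℕ) :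
    ∑ k ∈ Finset.range N, ‖(F (k+1)).starProjection x - (F k).starProjection x‖ ^ 2
      = ‖(F N).starProjection x‖ ^ 2 := by
  induction N with
  | zero =>
    have : (F 0).starProjection x ∈ F 0 := Submodule.starProjection_apply_mem _ x
    replace this := (Submodule.mem_bot ℂ).1 (h0.le this)
    simp [this]
  | succ N ih => rw [Finset.sum_range_succ, ih, filt_proj F hF]

theorem filt_norm (F : ℕ → Submodule ℂ K) [∀ k, FiniteDimensional ℂ (F k)] (hF : Monotone F)
    (c : ℕ → ℝ) (x : K) (N : ℕ) :
    (∑ k ∈ Finset.range N, (c k : ℂ) • ((F (k+1)).starProjection x - (F k).starProjection x) ∈ F N) ∧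
    ‖∑ k ∈ Finset.range N, (c k : ℂ) • ((F (k+1)).starProjection x - (F k).starProjection x)‖ ^ 2
      = ∑ k ∈ Finset.range N, c k ^ 2 *
        ‖(F (k+1)).starProjection x - (F k).starProjection x‖ ^ 2 := by
  induction N with
  | zero => simp
  | succ N ih =>
    rw [Finset.sum_range_succ, Finset.sum_range_succ]
    refine ⟨Submodule.add_mem _ (hF (Nat.le_succ N) ih.1) (Submodule.smul_mem _ _
      (Submodule.sub_mem _ (Submodule.starProjection_apply_mem _ x)
        (hF (Nat.le_succ N) (Submodule.starProjection_apply_mem _ x)))), ?_⟩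
    have h : (F N).starProjection ((F (N+1)).starProjection x) = (F N).starProjection x := by
      have := Submodule.starProjection_comp_starProjection_of_le (hF (Nat.le_succ N))
      exact congrArg (fun f => f x) this
    have h1 := (F N).sub_starProjection_mem_orthogonal ((F (N+1)).starProjection x)
    rw [h] at h1
    have hp := Submodule.inner_right_of_mem_orthogonal ih.1
      (Submodule.smul_mem _ ((c N : ℝ) : ℂ) h1)
    have := norm_add_sq_eq_norm_sq_add_norm_sq_of_inner_eq_zero _ _ hp
    rw [← pow_two, ← pow_two, ← pow_two, ih.2, norm_smul, mul_pow] at this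
    rw [this]
    simp

theorem filt_abel (F : ℕ → Submodule ℂ K) [∀ k, FiniteDimensional ℂ (F k)]
    (h0 : F 0 = ⊥) (c : ℕ → ℝ) (x : K) (N : ℕ) :
    ∑ k ∈ Finset.range N, (c k : ℂ) • ((F (k+1)).starProjection x - (F k).starProjection x)
      = (c N : ℂ) • (F N).starProjection x +
      ∑ k ∈ Finset.range N, ((c k : ℂ) - c (k+1)) • (F (k+1)).starProjection x := by
  induction N with
  | zero =>
    have : (F 0).starProjection x ∈ F 0 := Submodule.starProjection_apply_mem _ x
    replace this := (Submodule.mem_bot ℂ).1 (h0.le this)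
    simp [this]
  | succ N ih =>
    rw [Finset.sum_range_succ, Finset.sum_range_succ, ih]
    module

theorem filt_tri (F : ℕ → Submodule ℂ K) [∀ k, FiniteDimensional ℂ (F k)] (hF : Monotone F)
    (S : K →L[ℂ] K) (hS : ∀ k, ∀ x ∈ F k, S x ∈ F (k+1)) (x y : K) (k : ℕ) :
    inner ℂ (S ((F (k+1)).starProjection x) - (F (k+1)).starProjection (S ((F (k+1)).starProjection x))) y
     = inner ℂ (S ((F (k+1)).starProjection x - (F k).starProjection x))
        ((F (k+2)).starProjection y - (F (k+1)).starProjection y) := by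
  have e1 : S ((F (k+1)).starProjection x) -
      (F (k+1)).starProjection (S ((F (k+1)).starProjection x)) =
      S ((F (k+1)).starProjection x - (F k).starProjection x) -
      (F (k+1)).starProjection (S ((F (k+1)).starProjection x - (F k).starProjection x)) := by
    have : (F (k+1)).starProjection (S ((F k).starProjection x)) = S ((F k).starProjection x) :=
      Submodule.starProjection_eq_self_iff.2 (hS k _ (Submodule.starProjection_apply_mem _ x))
    rw [map_sub S, map_sub, this]; abel
  rw [e1]
  set z := S ((F (k+1)).starProjection x - (F k).starProjection x) with hz
  have hz2 : (F (k+2)).starProjection z = z := by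
    refine Submodule.starProjection_eq_self_iff.2 (hS (k+1) _ (Submodule.sub_mem _
      (Submodule.starProjection_apply_mem _ x) (hF (Nat.le_succ k)
        (Submodule.starProjection_apply_mem _ x))))
  rw [inner_sub_left, inner_sub_right, Submodule.inner_starProjection_left_eq_right,
    ← Submodule.inner_starProjection_left_eq_right (F (k+2)), hz2]

theorem filt_comm (F : ℕ → Submodule ℂ K) [∀ k, FiniteDimensional ℂ (F k)] (hF : Monotone F)
    (h0 : F 0 = ⊥) (S S' : K →L[ℂ] K) (hadj : ∀ x y, inner ℂ (S x) y = inner ℂ x (S' y))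
    (hS : ∀ k, ∀ x ∈ F k, S x ∈ F (k+1)) (hS' : ∀ k, ∀ x ∈ F k, S' x ∈ F (k+1))
    (c : ℕ → ℝ) (N : ℕ) (hN : c N = 0) (δ : ℝ) (hδ : ∀ k, |c k - c (k+1)| ≤ δ) (x : K)
    (d : K → K) (hd : ∀ x, d x = ∑ k ∈ Finset.range N,
      (c k : ℂ) • ((F (k+1)).starProjection x - (F k).starProjection x)) :
    ‖S (d x) - d (S x)‖ ≤ 2 * δ * ‖S‖ * ‖x‖ := by
  have hδ0 : 0 ≤ δ := (abs_nonneg _).trans (hδ 0)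
  let P : ℕ → K →L[ℂ] K := fun k => (F k).starProjection
  let D : ℕ → K → K := fun k x => P (k+1) x - P k x
  have hd2 : ∀ x, d x = ∑ k ∈ Finset.range N, ((c k : ℂ) - c (k+1)) • P (k+1) x := by
    intro x; rw [hd, filt_abel F h0, hN]; simp [P]
  have key : ∀ y, ‖inner ℂ (S (d x) - d (S x)) y‖ ≤ 2 * δ * ‖S‖ * ‖x‖ * ‖y‖ := by
    intro y
    have e1 : S (d x) - d (S x) = ∑ k ∈ Finset.range N,
        ((c k : ℂ) - c (k+1)) • (S (P (k+1) x) - P (k+1) (S x)) := by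
      rw [hd2, hd2, map_sum, ← Finset.sum_sub_distrib]
      refine Finset.sum_congr rfl fun k _ => ?_
      rw [map_smul, smul_sub]
    have e2 : ∀ k, inner ℂ (S (P (k+1) x) - P (k+1) (S x)) y =
        inner ℂ (S (D k x)) (D (k+1) y) - inner ℂ (S (D (k+1) x)) (D k y) := by
      intro k
      have t1 := filt_tri F hF S hS x y k
      have t2 := filt_tri F hF S' hS' y x k
      have t3 : inner ℂ (S (D (k+1) x)) (D k y) =
          inner ℂ x (S' (P (k+1) y) - P (k+1) (S' (P (k+1) y))) := by
        rw [← inner_conj_symm x, t2, inner_conj_symm, hadj]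
      rw [t3]
      change _ = inner ℂ (S ((F (k+1)).starProjection x - (F k).starProjection x))
        ((F (k+2)).starProjection y - (F (k+1)).starProjection y) - _
      rw [← t1]
      simp only [P, inner_sub_left, inner_sub_right, hadj,
        Submodule.inner_starProjection_left_eq_right]
      rw [← hadj x, ← Submodule.inner_starProjection_left_eq_right _ x, ← hadj]
      ring
    have hDn : ∀ (x : K) M, ∑ k ∈ Finset.range M, ‖D k x‖ ^ 2 ≤ ‖x‖ ^ 2 := by
      intro x M
      rw [show ∑ k ∈ Finset.range M, ‖D k x‖ ^ 2 = ‖(F M).starProjection x‖ ^ 2 from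
        filt_sum F hF h0 x M]
      have := Submodule.norm_starProjection_apply_le (F M) x
      gcongr
    have hDn' : ∀ (x : K), ∑ k ∈ Finset.range N, ‖D (k+1) x‖ ^ 2 ≤ ‖x‖ ^ 2 := by
      intro x
      have := hDn x (N+1)
      rw [Finset.sum_range_succ'] at this
      nlinarith [sq_nonneg ‖D 0 x‖]
    have cs : ∀ f g : ℕ → ℝ, (∑ k ∈ Finset.range N, f k ^ 2 ≤ ‖x‖ ^ 2) →
        (∑ k ∈ Finset.range N, g k ^ 2 ≤ ‖y‖ ^ 2) →
        ∑ k ∈ Finset.range N, f k * g k ≤ ‖x‖ * ‖y‖ := by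
      intro f g hf hg
      have h1 := Finset.sum_mul_sq_le_sq_mul_sq (Finset.range N) f g
      apply le_of_sq_le_sq _ (by positivity)
      calc _ ≤ _ := h1
        _ ≤ ‖x‖ ^ 2 * ‖y‖ ^ 2 := by
          apply mul_le_mul hf hg (Finset.sum_nonneg fun _ _ => sq_nonneg _) (sq_nonneg _)
        _ = _ := by ring
    have c1 := cs (fun k => ‖D k x‖) (fun k => ‖D (k+1) y‖) (hDn x N) (hDn' y)
    have c2 := cs (fun k => ‖D (k+1) x‖) (fun k => ‖D k y‖) (hDn' x) (hDn y N)
    rw [e1, sum_inner]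
    calc _ ≤ ∑ k ∈ Finset.range N, δ * ‖S‖ * (‖D k x‖ * ‖D (k+1) y‖ + ‖D (k+1) x‖ * ‖D k y‖) := by
          refine (norm_sum_le _ _).trans (Finset.sum_le_sum fun k _ => ?_)
          rw [inner_smul_left, norm_mul, e2, RCLike.norm_conj]
          have n1 : ‖(c k : ℂ) - c (k+1)‖ ≤ δ := by
            rw [← Complex.ofReal_sub, Complex.norm_real]; exact hδ k
          have n2 : ∀ u v : K, ‖inner ℂ (S u) v‖ ≤ ‖S‖ * (‖u‖ * ‖v‖) := by
            intro u v
            refine (norm_inner_le_norm _ _).trans ?_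
            rw [← mul_assoc]
            exact mul_le_mul_of_nonneg_right (S.le_opNorm u) (norm_nonneg _)
          have n3 := (norm_sub_le (inner ℂ (S (D k x)) (D (k+1) y))
            (inner ℂ (S (D (k+1) x)) (D k y))).trans (add_le_add (n2 _ _) (n2 _ _))
          calc _ ≤ δ * (‖S‖ * (‖D k x‖ * ‖D (k+1) y‖) + ‖S‖ * (‖D (k+1) x‖ * ‖D k y‖)) :=
                mul_le_mul n1 n3 (norm_nonneg _) hδ0
            _ = _ := by ring
      _ = δ * ‖S‖ * (∑ k ∈ Finset.range N, ‖D k x‖ * ‖D (k+1) y‖ +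
            ∑ k ∈ Finset.range N, ‖D (k+1) x‖ * ‖D k y‖) := by
          rw [← Finset.mul_sum, Finset.sum_add_distrib]
      _ ≤ δ * ‖S‖ * (‖x‖ * ‖y‖ + ‖x‖ * ‖y‖) := by gcongr
      _ = _ := by ring
  have h1 := key (S (d x) - d (S x))
  rw [inner_self_eq_norm_sq_to_K] at h1
  simp only [norm_pow, RCLike.norm_ofReal, abs_norm] at h1
  by_contra hcon
  push Not at hcon
  have : 0 ≤ 2 * δ * ‖S‖ * ‖x‖ := by positivity
  nlinarith

theorem filt_hasSum (F : ℕ → Submodule ℂ K) [∀ k, FiniteDimensional ℂ (F k)] (hF : Monotone F)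
    (h0 : F 0 = ⊥) (hd : ⊤ ≤ (⨆ k, F k).topologicalClosure) (x : K) :
    HasSum (fun k => ‖(F (k+1)).starProjection x - (F k).starProjection x‖ ^ 2) (‖x‖ ^ 2) := by
  rw [hasSum_iff_tendsto_nat_of_nonneg (fun _ => sq_nonneg _)]
  simp only [filt_sum F hF h0]
  exact ((Submodule.starProjection_tendsto_self F hF x hd).norm).pow 2

theorem exists_quasi (F : ℕ → Submodule ℂ K) [∀ k, FiniteDimensional ℂ (F k)] (hF : Monotone F)
    (h0 : F 0 = ⊥) (hdense : ⊤ ≤ (⨆ k, F k).topologicalClosure)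
    (S S' : K →L[ℂ] K) (hadj : ∀ x y, inner ℂ (S x) y = inner ℂ x (S' y))
    (hS : ∀ k, ∀ x ∈ F k, S x ∈ F (k+1)) (hS' : ∀ k, ∀ x ∈ F k, S' x ∈ F (k+1))
    (η : ℕ → ℝ) (hη : ∀ n, 0 < η n) :
    ∃ (d : ℕ → K →L[ℂ] K) (N : ℕ → ℕ), (∀ n x, d n x ∈ F (N n)) ∧
      (∀ x, HasSum (fun n => ‖d n x‖ ^ 2) (‖x‖ ^ 2)) ∧
      (∀ n x, ‖S (d n x) - d n (S x)‖ ≤ η n * ‖x‖) ∧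
      (∀ n x, ‖S' (d n x) - d n (S' x)‖ ≤ η n * ‖x‖) := by
  have hadj' : ∀ x y, inner ℂ (S' x) y = inner ℂ x (S y) := fun x y => by
    rw [← inner_conj_symm, ← hadj, inner_conj_symm]
  let M : ℝ := 2 * (‖S‖ + ‖S'‖ + 1)
  have hM : 0 < M := by positivity
  obtain ⟨c, N, hN, hc, hsum⟩ := exists_partition (fun n => η n / M) (fun n => div_pos (hη n) hM)
  let d : ℕ → K →L[ℂ] K := fun n => ∑ k ∈ Finset.range (N n),
      (c n k : ℂ) • ((F (k+1)).starProjection - (F k).starProjection)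
  have hd : ∀ n x, d n x = ∑ k ∈ Finset.range (N n),
      (c n k : ℂ) • ((F (k+1)).starProjection x - (F k).starProjection x) := by
    intro n x; simp [d]
  have hb : ∀ n (R : ℝ) (x : K), 2 * R ≤ M → 2 * (η n / M) * R * ‖x‖ ≤ η n * ‖x‖ := by
    intro n R x hR
    apply mul_le_mul_of_nonneg_right _ (norm_nonneg x)
    have : 2 * (η n / M) * R = η n * (2 * R / M) := by ring
    rw [this]
    exact mul_le_of_le_one_right (hη n).le ((div_le_one hM).2 hR)
  refine ⟨d, N, fun n x => ?_, fun x => ?_, fun n x => ?_, fun n x => ?_⟩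
  · rw [hd]; exact (filt_norm F hF (c n) x (N n)).1
  · let a : ℕ → ℝ := fun k => ‖(F (k+1)).starProjection x - (F k).starProjection x‖ ^ 2
    have ha : HasSum a (‖x‖ ^ 2) := filt_hasSum F hF h0 hdense x
    have hf1 : ∀ k, HasSum (fun n => c n k ^ 2 * a k) (a k) := fun k => by
      simpa using (hsum k).mul_right (a k)
    have hf2 : ∀ n, HasSum (fun k => c n k ^ 2 * a k) (‖d n x‖ ^ 2) := fun n => by
      rw [hd, (filt_norm F hF (c n) x (N n)).2]
      apply hasSum_sum_of_ne_finset_zero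
      intro k hk
      rw [Finset.mem_range, not_lt] at hk
      rw [hN n k hk]; simp
    let f : ℕ × ℕ → ℝ := fun p => c p.2 p.1 ^ 2 * a p.1
    have hfs : Summable f := by
      rw [summable_prod_of_nonneg (fun p => by positivity)]
      refine ⟨fun k => (hf1 k).summable, ?_⟩
      have : (fun k => ∑' n, f (k, n)) = a := funext fun k => (hf1 k).tsum_eq
      rw [this]; exact ha.summable
    have hft : HasSum f (‖x‖ ^ 2) := by
      have h1 := hfs.hasSum.prod_fiberwise hf1
      rw [← h1.unique ha]; exact hfs.hasSum
    have hft' : HasSum (f ∘ (Equiv.prodComm ℕ ℕ)) (‖x‖ ^ 2) := (Equiv.hasSum_iff _).2 hft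
    exact hft'.prod_fiberwise hf2
  · exact (filt_comm F hF h0 S S' hadj hS hS' (c n) (N n) (hN n _ le_rfl) _ (hc n) x (d n)
      (hd n)).trans (hb n _ x (by simp only [M]; linarith [norm_nonneg S']))
  · exact (filt_comm F hF h0 S' S hadj' hS' hS (c n) (N n) (hN n _ le_rfl) _ (hc n) x (d n)
      (hd n)).trans (hb n _ x (by simp only [M]; linarith [norm_nonneg S]))

end filt

section absorb
variable {K : Type*} [NormedAddCommGroup K] [InnerProductSpace ℂ K]
variable {H : Type*} [NormedAddCommGroup H] [InnerProductSpace ℂ H]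

def AppProp (F : ℕ → Submodule ℂ K) (S S' : K →L[ℂ] K) (T T' : H →L[ℂ] H) : Prop :=
  ∀ (n : ℕ) (G : Submodule ℂ H), FiniteDimensional ℂ G → ∀ ε : ℝ, 0 < ε →
    ∃ L : K →L[ℂ] H, (∀ x ∈ F (n+1), ‖L x‖ = ‖x‖) ∧ (∀ x ∈ F (n+1), L x ∈ Gᗮ) ∧
      (∀ x ∈ F n, ‖T (L x) - L (S x)‖ ≤ ε * ‖x‖) ∧
      (∀ x ∈ F n, ‖T' (L x) - L (S' x)‖ ≤ ε * ‖x‖)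

theorem exists_seqL (F : ℕ → Submodule ℂ K) [∀ k, FiniteDimensional ℂ (F k)]
    (S S' : K →L[ℂ] K) (T T' : H →L[ℂ] H)
    (hP : AppProp F S S' T T') (N : ℕ → ℕ) (ε : ℕ → ℝ) (hε : ∀ j, 0 < ε j) :
    ∃ L : ℕ → K →L[ℂ] H, (∀ j, ∀ x ∈ F (N j+1), ‖L j x‖ = ‖x‖) ∧
      (∀ i j, i ≠ j → ∀ x ∈ F (N i + 1), ∀ y ∈ F (N j + 1), inner ℂ (L i x) (L j y) = 0) ∧
      (∀ j, ∀ x ∈ F (N j), ‖T (L j x) - L j (S x)‖ ≤ ε j * ‖x‖) ∧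
      (∀ j, ∀ x ∈ F (N j), ‖T' (L j x) - L j (S' x)‖ ≤ ε j * ‖x‖) := by
  have hP' : ∀ (j : ℕ) (G : {G : Submodule ℂ H // FiniteDimensional ℂ G}), ∃ L : K →L[ℂ] H,
      (∀ x ∈ F (N j+1), ‖L x‖ = ‖x‖) ∧ (∀ x ∈ F (N j+1), L x ∈ G.1ᗮ) ∧
      (∀ x ∈ F (N j), ‖T (L x) - L (S x)‖ ≤ ε j * ‖x‖) ∧
      (∀ x ∈ F (N j), ‖T' (L x) - L (S' x)‖ ≤ ε j * ‖x‖) :=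
    fun j G => hP (N j) G.1 G.2 (ε j) (hε j)
  choose Φ h1 h2 h3 h4 using hP'
  obtain ⟨G, hG⟩ : ∃ G : ℕ → {G : Submodule ℂ H // FiniteDimensional ℂ G},
      ∀ j, (G (j+1)).1 = (G j).1 ⊔ (F (N j + 1)).map (Φ j (G j)).toLinearMap := by
    refine ⟨fun j => Nat.rec (motive := fun _ => {G : Submodule ℂ H // FiniteDimensional ℂ G})
      ⟨⊥, inferInstance⟩ (fun j G => ⟨G.1 ⊔ (F (N j + 1)).map (Φ j G).toLinearMap, ?_⟩) j,
      fun j => rfl⟩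
    have := G.2
    infer_instance
  have hmono : Monotone fun j => (G j).1 := monotone_nat_of_le_succ fun j => by
    rw [hG]; exact le_sup_left
  have hmem : ∀ i j, i < j → ∀ x ∈ F (N i + 1), Φ i (G i) x ∈ (G j).1 := by
    intro i j hij x hx
    refine hmono (Nat.succ_le_of_lt hij) ?_
    change _ ∈ (G (i+1)).1
    rw [hG]
    exact (le_sup_right : _ ≤ (G i).1 ⊔ _) (Submodule.mem_map_of_mem hx)
  have hlt : ∀ i j, i < j → ∀ x ∈ F (N i + 1), ∀ y ∈ F (N j + 1),
      inner ℂ (Φ i (G i) x) (Φ j (G j) y) = 0 := fun i j hij x hx y hy =>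
    Submodule.inner_right_of_mem_orthogonal (hmem i j hij x hx) (h2 j (G j) y hy)
  refine ⟨fun j => Φ j (G j), fun j => h1 j _, ?_, fun j => h3 j _, fun j => h4 j _⟩
  intro i j hij x hx y hy
  rcases lt_or_gt_of_ne hij with h | h
  · exact hlt i j h x hx y hy
  · rw [← inner_conj_symm, hlt j i h y hy x hx, map_zero]

theorem exists_sum_isometry [CompleteSpace H] (X : ℕ → K →L[ℂ] H)
    (hX : ∀ i j, i ≠ j → ∀ x y, inner ℂ (X i x) (X j y) = 0)
    (hn : ∀ x, HasSum (fun n => ‖X n x‖ ^ 2) (‖x‖ ^ 2)) :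
    ∃ J : K →ₗᵢ[ℂ] H, ∀ x, HasSum (fun n => X n x) (J x) := by
  let R : ℕ → Submodule ℂ H := fun n => LinearMap.range (X n).toLinearMap
  have hO : OrthogonalFamily ℂ (fun n => R n) (fun n => (R n).subtypeₗᵢ) := by
    rintro i j hij ⟨_, x, rfl⟩ ⟨_, y, rfl⟩
    exact hX i j hij x y
  let f : K → ∀ n, R n := fun x n => ⟨X n x, ⟨x, rfl⟩⟩
  have hs : ∀ x, Summable fun n => X n x := fun x =>
    (hO.summable_iff_norm_sq_summable (f x)).2 (hn x).summable
  let J0 : K →ₗ[ℂ] H :=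
    { toFun := fun x => ∑' n, X n x
      map_add' := fun x y => by simp only [map_add]; exact (hs x).tsum_add (hs y)
      map_smul' := fun c x => by simp only [map_smul]; exact (hs x).tsum_const_smul c }
  have hJ : ∀ x, HasSum (fun n => X n x) (J0 x) := fun x => (hs x).hasSum
  refine ⟨⟨J0, fun x => ?_⟩, hJ⟩
  have t1 := ((hJ x).norm.pow 2)
  have t2 : (fun s : Finset ℕ => ‖∑ n ∈ s, X n x‖ ^ 2) = fun s => ∑ n ∈ s, ‖X n x‖ ^ 2 :=
    funext fun s => hO.norm_sum (f x) s
  rw [t2] at t1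
  have := tendsto_nhds_unique t1 (hn x)
  exact (sq_eq_sq₀ (norm_nonneg _) (norm_nonneg _)).1 this

theorem exists_J [CompleteSpace H] (F : ℕ → Submodule ℂ K) [∀ k, FiniteDimensional ℂ (F k)]
    (hF : Monotone F)
    (h0 : F 0 = ⊥) (hdense : ⊤ ≤ (⨆ k, F k).topologicalClosure)
    (S S' : K →L[ℂ] K) (hadj : ∀ x y, inner ℂ (S x) y = inner ℂ x (S' y))
    (hS : ∀ k, ∀ x ∈ F k, S x ∈ F (k+1)) (hS' : ∀ k, ∀ x ∈ F k, S' x ∈ F (k+1))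
    (T T' : H →L[ℂ] H) (hP : AppProp F S S' T T') (δ : ℕ → ℝ) (hδ : ∀ m, 0 < δ m) :
    ∃ J : ℕ → K →ₗᵢ[ℂ] H, (∀ i j, i ≠ j → ∀ x y, inner ℂ (J i x) (J j y) = 0) ∧
      (∀ m x, ‖T (J m x) - J m (S x)‖ ≤ δ m * ‖x‖) ∧
      (∀ m x, ‖T' (J m x) - J m (S' x)‖ ≤ δ m * ‖x‖) := by
  let e : ℕ → ℕ → ℝ := fun m n => δ m * (1 / 2) ^ n / 4
  have he : ∀ m n, 0 < e m n := fun m n => by have := hδ m; positivity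
  have hes : ∀ m, HasSum (fun n => 2 * e m n) (δ m) := fun m => by
    have h1 := hasSum_geometric_two.mul_left (δ m / 2)
    have h2 : δ m / 2 * 2 = δ m := by ring
    rw [h2] at h1
    have h3 : (fun n => 2 * e m n) = fun n => δ m / 2 * (1 / 2) ^ n := by
      funext n; simp only [e]; ring
    rw [h3]; exact h1
  choose d N hdN hds hd1 hd2 using fun m =>
    exists_quasi F hF h0 hdense S S' hadj hS hS' (e m) (he m)
  obtain ⟨L, hL1, hL2, hL3, hL4⟩ := exists_seqL F S S' T T' hP
    (fun j => N j.unpair.1 j.unpair.2) (fun j => e j.unpair.1 j.unpair.2) (fun j => he _ _)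
  let V : ℕ → ℕ → K →L[ℂ] H := fun m n => L (Nat.pair m n)
  have hV1 : ∀ m n, ∀ x ∈ F (N m n + 1), ‖V m n x‖ = ‖x‖ := fun m n x hx =>
    hL1 (Nat.pair m n) x (by simpa using hx)
  have hV2 : ∀ m n m' n', Nat.pair m n ≠ Nat.pair m' n' → ∀ x ∈ F (N m n + 1),
      ∀ y ∈ F (N m' n' + 1), inner ℂ (V m n x) (V m' n' y) = 0 := fun m n m' n' h x hx y hy =>
    hL2 _ _ h x (by simpa using hx) y (by simpa using hy)
  have hV3 : ∀ m n, ∀ x ∈ F (N m n), ‖T (V m n x) - V m n (S x)‖ ≤ e m n * ‖x‖ := fun m n x hx => by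
    simpa using hL3 (Nat.pair m n) x (by simpa using hx)
  have hV4 : ∀ m n, ∀ x ∈ F (N m n), ‖T' (V m n x) - V m n (S' x)‖ ≤ e m n * ‖x‖ :=
    fun m n x hx => by
      simpa using hL4 (Nat.pair m n) x (by simpa using hx)
  have hdN' : ∀ m n x, d m n x ∈ F (N m n + 1) := fun m n x => hF (Nat.le_succ _) (hdN m n x)
  have hdle : ∀ m n x, ‖d m n x‖ ≤ ‖x‖ := fun m n x => by
    have := le_hasSum (hds m x) n (fun _ _ => sq_nonneg _)
    exact (sq_le_sq₀ (norm_nonneg _) (norm_nonneg _)).1 this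
  let X : ℕ → ℕ → K →L[ℂ] H := fun m n => (V m n).comp (d m n)
  have hX : ∀ m n x, X m n x = V m n (d m n x) := fun _ _ _ => rfl
  have hJ : ∀ m, ∃ J : K →ₗᵢ[ℂ] H, ∀ x, HasSum (fun n => X m n x) (J x) := by
    intro m
    refine exists_sum_isometry (X m) (fun i j hij x y => ?_) (fun x => ?_)
    · refine hV2 _ _ _ _ (fun h => hij ?_) _ (hdN' _ _ _) _ (hdN' _ _ _)
      exact (Nat.pair_eq_pair.1 h).2
    · simpa only [hX, hV1 _ _ _ (hdN' m _ x)] using hds m x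
  choose J hJ using hJ
  have main : ∀ (A : H →L[ℂ] H) (R : K →L[ℂ] K), (∀ k, ∀ x ∈ F k, R x ∈ F (k+1)) →
      (∀ m n, ∀ x ∈ F (N m n), ‖A (V m n x) - V m n (R x)‖ ≤ e m n * ‖x‖) →
      (∀ m n x, ‖R (d m n x) - d m n (R x)‖ ≤ e m n * ‖x‖) →
      ∀ m x, ‖A (J m x) - J m (R x)‖ ≤ δ m * ‖x‖ := by
    intro A R hR hA hd m x
    have s1 : HasSum (fun n => A (X m n x) - X m n (R x)) (A (J m x) - J m (R x)) :=
      ((hJ m x).mapL A).sub (hJ m (R x))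
    refine s1.norm_le_of_bounded ((hes m).mul_right ‖x‖) fun n => ?_
    have e1 : A (X m n x) - X m n (R x) = (A (V m n (d m n x)) - V m n (R (d m n x))) +
        V m n (R (d m n x) - d m n (R x)) := by
      rw [hX, hX, map_sub]; abel
    rw [e1]
    refine (norm_add_le _ _).trans ?_
    rw [hV1 m n _ (Submodule.sub_mem _ (hR _ _ (hdN m n x)) (hdN' m n _))]
    have b1 := hA m n _ (hdN m n x)
    have b2 := mul_le_mul_of_nonneg_left (hdle m n x) (he m n).le
    linarith [hd m n x]
  refine ⟨J, fun i j hij x y => ?_, main T S hS hV3 hd1, main T' S' hS' hV4 hd2⟩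
  have z1 : ∀ n, inner ℂ (X i n x) (J j y) = 0 := fun n => by
    have h2 : HasSum (fun n' => inner ℂ (X i n x) (X j n' y)) (inner ℂ (X i n x) (J j y)) :=
      (hJ j y).mapL (innerSL ℂ (X i n x))
    have h3 : (fun n' => inner ℂ (X i n x) (X j n' y)) = fun _ => 0 := by
      funext n'
      refine hV2 _ _ _ _ (fun h => hij ?_) _ (hdN' _ _ _) _ (hdN' _ _ _)
      exact (Nat.pair_eq_pair.1 h).1
    rw [h3] at h2
    exact h2.unique hasSum_zero
  have h2 : HasSum (fun n => inner ℂ (J j y) (X i n x)) (inner ℂ (J j y) (J i x)) :=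
      (hJ i x).mapL (innerSL ℂ (J j y))
  have h3 : (fun n => inner ℂ (J j y) (X i n x)) = fun _ => 0 := by
    funext n
    rw [← inner_conj_symm, z1, map_zero]
  rw [h3] at h2
  rw [← inner_conj_symm, h2.unique hasSum_zero, map_zero]

end absorb

section unit
variable {K : Type*} [NormedAddCommGroup K] [InnerProductSpace ℂ K] [CompleteSpace K]
variable {H : Type*} [NormedAddCommGroup H] [InnerProductSpace ℂ H] [CompleteSpace H]

theorem exists_U (J : ℕ → K →ₗᵢ[ℂ] H)
    (hJ : ∀ i j, i ≠ j → ∀ x y, inner ℂ (J i x) (J j y) = 0)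
    (S S' : K →L[ℂ] K) (hadj : ∀ x y, inner ℂ (S x) y = inner ℂ x (S' y))
    (T T' : H →L[ℂ] H) (hadjT : ∀ x y, inner ℂ (T x) y = inner ℂ x (T' y))
    (ε : ℝ) (hε : 0 < ε)
    (hJ1 : ∀ m x, ‖T (J m x) - J m (S x)‖ ≤ (ε / 16 * (1 / 2) ^ m) * ‖x‖)
    (hJ2 : ∀ m x, ‖T' (J m x) - J m (S' x)‖ ≤ (ε / 16 * (1 / 2) ^ m) * ‖x‖) :
    ∃ U : WithLp 2 (H × K) ≃ₗᵢ[ℂ] H, ∀ h x,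
      ‖T (U (WithLp.toLp 2 (h, x))) - U (WithLp.toLp 2 (T h, S x))‖
        ≤ ε * ‖(WithLp.toLp 2 (h, x) : WithLp 2 (H × K))‖ := by
  classical
  have hO : OrthogonalFamily ℂ (fun _ : ℕ => K) J := fun i j hij x y => hJ i j hij x y
  have hO' : OrthogonalFamily ℂ (fun _ : ℕ => K) (fun m => J (m+1)) :=
    fun i j hij x y => hJ (i+1) (j+1) (by omega) x y
  let j := hO.linearIsometry
  let j' := hO'.linearIsometry
  have hj : ∀ b, HasSum (fun m => J m (b m)) (j b) := fun b => hO.hasSum_linearIsometry b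
  have hj' : ∀ b, HasSum (fun m => J (m+1) (b m)) (j' b) := fun b => hO'.hasSum_linearIsometry b
  let a : H →L[ℂ] lp (fun _ : ℕ => K) 2 := ContinuousLinearMap.adjoint j.toContinuousLinearMap
  let Ja : ℕ → H →L[ℂ] K := fun m => ContinuousLinearMap.adjoint (J m).toContinuousLinearMap
  have hJa : ∀ m h v, inner ℂ v (Ja m h) = inner ℂ (J m v) h := fun m h v =>
    ContinuousLinearMap.adjoint_inner_right _ _ _
  have haj : ∀ h b, inner ℂ b (a h) = inner ℂ (j b) h := fun h b =>
    ContinuousLinearMap.adjoint_inner_right _ _ _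
  have ha : ∀ h m, a h m = Ja m h := by
    intro h m
    refine ext_inner_left ℂ fun v => ?_
    rw [hJa, ← hO.linearIsometry_apply_single, ← haj, lp.inner_single_left]
  have hJan : ∀ m h, ‖Ja m h‖ ≤ ‖h‖ := by
    intro m h
    refine (Ja m).le_of_opNorm_le ?_ h |>.trans (by rw [one_mul])
    simp only [Ja]
    rw [LinearIsometryEquiv.norm_map]
    exact (J m).norm_toContinuousLinearMap_le
  have haself : ∀ b, a (j b) = b := by
    intro b
    refine ext_inner_left ℂ fun v => ?_
    rw [haj, j.inner_map_map]
  have p1 : ∀ h b, inner ℂ (h - j (a h)) (j b) = 0 := by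
    intro h b
    have : a (h - j (a h)) = 0 := by rw [map_sub, haself, sub_self]
    rw [← inner_conj_symm, ← haj, this, inner_zero_right, map_zero]
  have p1' : ∀ h m v, inner ℂ (h - j (a h)) (J m v) = 0 := by
    intro h m v
    rw [← hO.linearIsometry_apply_single]
    exact p1 _ _
  have p2 : ∀ h b, inner ℂ (h - j (a h)) (j' b) = 0 := by
    intro h b
    have h2 : HasSum (fun m => inner ℂ (h - j (a h)) (J (m+1) (b m)))
        (inner ℂ (h - j (a h)) (j' b)) := (hj' b).mapL (innerSL ℂ (h - j (a h)))
    simp only [p1'] at h2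
    exact h2.unique hasSum_zero
  have p3 : ∀ x b, inner ℂ (J 0 x) (j' b) = 0 := by
    intro x b
    have h2 : HasSum (fun m => inner ℂ (J 0 x) (J (m+1) (b m)))
        (inner ℂ (J 0 x) (j' b)) := (hj' b).mapL (innerSL ℂ (J 0 x))
    have : ∀ m, inner ℂ (J 0 x) (J (m+1) (b m)) = 0 := fun m => hJ 0 (m+1) (by omega) _ _
    simp only [this] at h2
    exact h2.unique hasSum_zero
  let U0 : WithLp 2 (H × K) →ₗ[ℂ] H :=
    { toFun := fun w => (w.fst - j (a w.fst)) + (j' (a w.fst) + J 0 w.snd)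
      map_add' := fun w w' => by simp only [WithLp.add_fst, WithLp.add_snd, map_add]; abel
      map_smul' := fun c w => by
        simp only [WithLp.smul_fst, WithLp.smul_snd, map_smul, RingHom.id_apply]; module }
  have hU0 : ∀ w, U0 w = (w.fst - j (a w.fst)) + (j' (a w.fst) + J 0 w.snd) := fun w => rfl
  have hnorm : ∀ w, ‖U0 w‖ = ‖w‖ := by
    intro w
    have e1 : ‖U0 w‖ ^ 2 = ‖w.fst - j (a w.fst)‖ ^ 2 + (‖a w.fst‖ ^ 2 + ‖w.snd‖ ^ 2) := by
      rw [hU0, pow_two, norm_add_sq_eq_norm_sq_add_norm_sq_of_inner_eq_zero (𝕜 := ℂ),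
        norm_add_sq_eq_norm_sq_add_norm_sq_of_inner_eq_zero (𝕜 := ℂ), j'.norm_map, (J 0).norm_map]
      · ring
      · rw [← inner_conj_symm, p3, map_zero]
      · rw [inner_add_right, p2, p1', add_zero]
    have e2 : ‖w.fst‖ ^ 2 = ‖w.fst - j (a w.fst)‖ ^ 2 + ‖a w.fst‖ ^ 2 := by
      have := norm_add_sq_eq_norm_sq_add_norm_sq_of_inner_eq_zero _ _ (p1 w.fst (a w.fst))
      rw [sub_add_cancel, j.norm_map] at this
      nlinarith [this]
    have e3 := WithLp.prod_norm_sq_eq_of_L2 w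
    refine (sq_eq_sq₀ (norm_nonneg _) (norm_nonneg _)).1 ?_
    rw [e1, e3, e2]; ring
  let U1 : WithLp 2 (H × K) →ₗᵢ[ℂ] H := ⟨U0, hnorm⟩
  have hU1 : ∀ h x, U1 (WithLp.toLp 2 (h, x)) = (h - j (a h)) + (j' (a h) + J 0 x) :=
    fun h x => rfl
  have hsurj : Function.Surjective U1 := by
    have hcl : IsClosed (LinearMap.range U1.toLinearMap : Set H) :=
      U1.isometry.isClosedEmbedding.isClosed_range
    have : CompleteSpace (LinearMap.range U1.toLinearMap) := hcl.completeSpace_coe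
    have hb : (LinearMap.range U1.toLinearMap)ᗮ = ⊥ := by
      rw [Submodule.eq_bot_iff]
      intro y hy
      have hy' : ∀ h x, inner ℂ (U1 (WithLp.toLp 2 (h, x))) y = 0 := fun h x =>
        (Submodule.mem_orthogonal _ _).1 hy _ ⟨_, rfl⟩
      have y0 : ∀ x, inner ℂ (J 0 x) y = 0 := fun x => by
        have := hy' 0 x
        rw [hU1] at this; simpa using this
      have y1 : ∀ b, inner ℂ (j' b) y = 0 := fun b => by
        have := hy' (j b) 0
        rw [hU1, haself] at this; simpa using this
      have y2 : ∀ m, Ja m y = 0 := by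
        intro m
        refine ext_inner_left ℂ fun v => ?_
        rw [hJa, inner_zero_right]
        cases m with
        | zero => exact y0 v
        | succ m =>
          have := y1 (lp.single 2 m v)
          rwa [hO'.linearIsometry_apply_single] at this
      have y3 : a y = 0 := by
        ext m
        rw [ha, y2]; rfl
      have := hy' y 0
      rw [hU1, y3] at this
      simpa using this
    have ht := (Submodule.orthogonal_eq_bot_iff).1 hb
    exact LinearMap.range_eq_top.1 ht
  refine ⟨LinearIsometryEquiv.ofSurjective U1 hsurj, fun h x => ?_⟩
  rw [LinearIsometryEquiv.coe_ofSurjective, hU1, hU1]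
  let δ : ℕ → ℝ := fun m => ε / 16 * (1 / 2) ^ m
  have hδ0 : ∀ m, 0 ≤ δ m := fun m => by positivity
  have hδs : HasSum (fun m => 2 * δ m) (ε / 4) := by
    have h1 := hasSum_geometric_two.mul_left (ε / 8)
    have h2 : ε / 8 * 2 = ε / 4 := by ring
    rw [h2] at h1
    have h3 : (fun n => 2 * δ n) = fun n => ε / 8 * (1 / 2) ^ n := by
      funext n; simp only [δ]; ring
    rw [h3]; exact h1
  have hδle : ∀ m, δ (m+1) ≤ δ m := fun m => by
    have : δ (m+1) = δ m * (1/2) := by simp only [δ]; ring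
    rw [this]; linarith [hδ0 m]
  have hJa2 : ∀ m h, ‖S (Ja m h) - Ja m (T h)‖ ≤ δ m * ‖h‖ := by
    intro m h
    have e0 : ∀ w, inner ℂ (S (Ja m h) - Ja m (T h)) w
        = inner ℂ h (J m (S' w) - T' (J m w)) := by
      intro w
      rw [inner_sub_left, inner_sub_right, hadj, ← inner_conj_symm (Ja m h), hJa, inner_conj_symm,
        ← inner_conj_symm (Ja m (T h)), hJa, inner_conj_symm, hadjT]
    set z := S (Ja m h) - Ja m (T h) with hz
    have e1 := e0 z
    have e2 : ‖z‖ ^ 2 ≤ ‖h‖ * (δ m * ‖z‖) := by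
      have := norm_inner_le_norm (𝕜 := ℂ) h (J m (S' z) - T' (J m z))
      rw [← e1, inner_self_eq_norm_sq_to_K] at this
      simp only [norm_pow, RCLike.norm_ofReal, abs_norm] at this
      refine this.trans (mul_le_mul_of_nonneg_left ?_ (norm_nonneg _))
      rw [norm_sub_rev]; exact hJ2 m z
    by_contra hcon
    push Not at hcon
    have : 0 ≤ δ m * ‖h‖ := mul_nonneg (hδ0 m) (norm_nonneg h)
    nlinarith
  have bound : ∀ (σ : ℕ → ℕ) (V : lp (fun _ : ℕ => K) 2 →ₗᵢ[ℂ] H), (∀ m, δ (σ m) ≤ δ m) →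
      (∀ b, HasSum (fun m => J (σ m) (b m)) (V b)) →
      ‖T (V (a h)) - V (a (T h))‖ ≤ ε / 4 * ‖h‖ := by
    intro σ V hσ hV
    have s1 := ((hV (a h)).mapL T).sub (hV (a (T h)))
    refine s1.norm_le_of_bounded (hδs.mul_right ‖h‖) fun m => ?_
    rw [ha, ha]
    have e1 : T (J (σ m) (Ja m h)) - J (σ m) (Ja m (T h)) =
      (T (J (σ m) (Ja m h)) - J (σ m) (S (Ja m h))) + J (σ m) (S (Ja m h) - Ja m (T h)) := by
      rw [map_sub]; abel
    rw [e1]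
    refine (norm_add_le _ _).trans ?_
    rw [(J (σ m)).norm_map]
    have b1 : ‖T (J (σ m) (Ja m h)) - J (σ m) (S (Ja m h))‖ ≤ δ (σ m) * ‖Ja m h‖ := hJ1 _ _
    have b2 : δ (σ m) * ‖Ja m h‖ ≤ δ m * ‖h‖ :=
      mul_le_mul (hσ m) (hJan m h) (norm_nonneg _) (hδ0 m)
    linarith [hJa2 m h]
  have b1 := bound id j (fun m => le_rfl) hj
  have b2 := bound (fun m => m + 1) j' hδle hj'
  have b3 : ‖T (J 0 x) - J 0 (S x)‖ ≤ ε / 16 * ‖x‖ := by simpa using hJ1 0 x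
  have e : T ((h - j (a h)) + (j' (a h) + J 0 x)) - ((T h - j (a (T h))) + (j' (a (T h)) + J 0 (S x)))
      = -(T (j (a h)) - j (a (T h))) + (T (j' (a h)) - j' (a (T h))) +
        (T (J 0 x) - J 0 (S x)) := by
    simp only [map_add, map_sub]; abel
  rw [e]
  have n1 : ‖h‖ ≤ ‖(WithLp.toLp 2 (h, x) : WithLp 2 (H × K))‖ := by
    refine (sq_le_sq₀ (norm_nonneg _) (norm_nonneg _)).1 ?_
    rw [WithLp.prod_norm_sq_eq_of_L2]
    exact le_add_of_nonneg_right (sq_nonneg ‖x‖)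
  have n2 : ‖x‖ ≤ ‖(WithLp.toLp 2 (h, x) : WithLp 2 (H × K))‖ := by
    refine (sq_le_sq₀ (norm_nonneg _) (norm_nonneg _)).1 ?_
    rw [WithLp.prod_norm_sq_eq_of_L2]
    exact le_add_of_nonneg_left (sq_nonneg ‖h‖)
  have n3 := (norm_add_le (-(T (j (a h)) - j (a (T h))) + (T (j' (a h)) - j' (a (T h))))
    (T (J 0 x) - J 0 (S x))).trans (add_le_add (norm_add_le _ _) le_rfl)
  rw [norm_neg] at n3
  have n4 := mul_le_mul_of_nonneg_left n1 hε.le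
  have n5 := mul_le_mul_of_nonneg_left n2 hε.le
  linarith [mul_nonneg hε.le (norm_nonneg h), mul_nonneg hε.le (norm_nonneg x)]

theorem exists_U' (F : ℕ → Submodule ℂ K) [∀ k, FiniteDimensional ℂ (F k)]
    (hF : Monotone F)
    (h0 : F 0 = ⊥) (hdense : ⊤ ≤ (⨆ k, F k).topologicalClosure)
    (S S' : K →L[ℂ] K) (hadj : ∀ x y, inner ℂ (S x) y = inner ℂ x (S' y))
    (hS : ∀ k, ∀ x ∈ F k, S x ∈ F (k+1)) (hS' : ∀ k, ∀ x ∈ F k, S' x ∈ F (k+1))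
    (T T' : H →L[ℂ] H) (hadjT : ∀ x y, inner ℂ (T x) y = inner ℂ x (T' y))
    (hP : AppProp F S S' T T') (ε : ℝ) (hε : 0 < ε) :
    ∃ U : WithLp 2 (H × K) ≃ₗᵢ[ℂ] H, ∀ h x,
      ‖T (U (WithLp.toLp 2 (h, x))) - U (WithLp.toLp 2 (T h, S x))‖
        ≤ ε * ‖(WithLp.toLp 2 (h, x) : WithLp 2 (H × K))‖ := by
  obtain ⟨J, hJ, hJ1, hJ2⟩ := exists_J F hF h0 hdense S S' hadj hS hS' T T' hP
    (fun m => ε / 16 * (1 / 2) ^ m) (fun m => by positivity)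
  exact exists_U J hJ S S' hadj T T' hadjT ε hε hJ1 hJ2

end unit

section ultra

universe uu vv

theorem exists_completion (E : Type uu) [AddCommGroup E] [Module ℂ E]
    (core : PreInnerProductSpace.Core ℂ E) :
    ∃ (X : Type uu) (_ : NormedAddCommGroup X) (_ : InnerProductSpace ℂ X) (_ : CompleteSpace X)
      (q : E →ₗ[ℂ] X), DenseRange q ∧ ∀ f g, inner ℂ (q f) (q g) = core.inner f g := by
  let _ : SeminormedAddCommGroup E := InnerProductSpace.Core.toSeminormedAddCommGroup (𝕜 := ℂ)
  let _ : InnerProductSpace ℂ E := InnerProductSpace.ofCore core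
  refine ⟨UniformSpace.Completion E, inferInstance, inferInstance, inferInstance,
    (UniformSpace.Completion.toComplₗᵢ (𝕜 := ℂ) (E := E)).toLinearMap, ?_, ?_⟩
  · exact UniformSpace.Completion.denseRange_coe
  · intro f g
    exact UniformSpace.Completion.inner_coe f g

def bddFun (ι : Type uu) (H : Type vv) [NormedAddCommGroup H] [InnerProductSpace ℂ H] :
    Submodule ℂ (ι → H) where
  carrier := {f | ∃ C, ∀ i, ‖f i‖ ≤ C}
  add_mem' := by
    rintro f g ⟨C, hC⟩ ⟨D, hD⟩
    exact ⟨C + D, fun i => (norm_add_le _ _).trans (add_le_add (hC i) (hD i))⟩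
  zero_mem' := ⟨0, fun i => by simp⟩
  smul_mem' := by
    rintro c f ⟨C, hC⟩
    exact ⟨‖c‖ * C, fun i => by
      rw [Pi.smul_apply, norm_smul]
      exact mul_le_mul_of_nonneg_left (hC i) (norm_nonneg _)⟩

variable {ι : Type uu} {H : Type uu} [NormedAddCommGroup H] [InnerProductSpace ℂ H]

theorem exists_lim (u : Ultrafilter ι) (f g : bddFun ι H) :
    ∃ z : ℂ, Tendsto (fun i => inner ℂ (f.1 i) (g.1 i)) u (𝓝 z) := by
  obtain ⟨C, hC⟩ := f.2
  obtain ⟨D, hD⟩ := g.2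
  have hb : ∀ i, inner ℂ (f.1 i) (g.1 i) ∈ Metric.closedBall (0 : ℂ) (C * D) := fun i => by
    rw [mem_closedBall_zero_iff]
    exact (norm_inner_le_norm _ _).trans
      (mul_le_mul (hC i) (hD i) (norm_nonneg _) ((norm_nonneg _).trans (hC i)))
  obtain ⟨z, -, hz⟩ := (isCompact_closedBall (0 : ℂ) (C * D)).ultrafilter_le_nhds
    (u.map (fun i => inner ℂ (f.1 i) (g.1 i)))
    (by
      rw [le_principal_iff]
      exact Filter.mem_map.2 (Filter.univ_mem' hb))
  exact ⟨z, hz⟩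

theorem exists_ultra (u : Ultrafilter ι) :
    ∃ (X : Type uu) (_ : NormedAddCommGroup X) (_ : InnerProductSpace ℂ X) (_ : CompleteSpace X)
      (q : bddFun ι H →ₗ[ℂ] X), DenseRange q ∧
        ∀ f g, Tendsto (fun i => inner ℂ (f.1 i) (g.1 i)) u (𝓝 (inner ℂ (q f) (q g))) := by
  choose L hL using exists_lim (H := H) u
  let core : PreInnerProductSpace.Core ℂ (bddFun ι H) :=
    { inner := L
      conj_inner_symm := fun f g => by
        refine tendsto_nhds_unique ?_ (hL f g)
        have := (Complex.continuous_conj.tendsto _).comp (hL g f)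
        refine this.congr fun i => ?_
        exact inner_conj_symm _ _
      re_inner_nonneg := fun f => by
        have := (Complex.continuous_re.tendsto _).comp (hL f f)
        exact ge_of_tendsto' this fun i => inner_self_nonneg (𝕜 := ℂ)
      add_left := fun f g h => by
        refine tendsto_nhds_unique (hL (f+g) h) ?_
        refine ((hL f h).add (hL g h)).congr fun i => ?_
        exact (inner_add_left _ _ _).symm
      smul_left := fun f g c => by
        refine tendsto_nhds_unique (hL (c • f) g) ?_
        refine ((hL f g).const_mul _).congr fun i => ?_
        exact (inner_smul_left _ _ _).symm }
  obtain ⟨X, i1, i2, i3, q, hq, hin⟩ := exists_completion _ core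
  refine ⟨X, i1, i2, i3, q, hq, fun f g => ?_⟩
  rw [hin]
  exact hL f g

def bddMap (ι : Type uu) (T : H →L[ℂ] H) : bddFun ι H →ₗ[ℂ] bddFun ι H where
  toFun f := ⟨fun i => T (f.1 i), by
    obtain ⟨C, hC⟩ := f.2
    exact ⟨‖T‖ * C, fun i => (T.le_opNorm _).trans
      (mul_le_mul_of_nonneg_left (hC i) (norm_nonneg _))⟩⟩
  map_add' f g := by ext i; exact map_add T _ _
  map_smul' c f := by ext i; exact map_smul T _ _

variable {X : Type uu} [NormedAddCommGroup X] [InnerProductSpace ℂ X] [CompleteSpace X]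

theorem tendsto_norm_q (u : Ultrafilter ι) (q : bddFun ι H →ₗ[ℂ] X)
    (hq : ∀ f g, Tendsto (fun i => inner ℂ (f.1 i) (g.1 i)) u (𝓝 (inner ℂ (q f) (q g))))
    (f : bddFun ι H) : Tendsto (fun i => ‖f.1 i‖) u (𝓝 ‖q f‖) := by
  have h1 : Tendsto (fun i => ‖f.1 i‖ ^ 2) u (𝓝 (‖q f‖ ^ 2)) := by
    have := (Complex.continuous_re.tendsto _).comp (hq f f)
    have e : ∀ (Y : Type uu) [NormedAddCommGroup Y] [InnerProductSpace ℂ Y] (y : Y),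
        (inner ℂ y y).re = ‖y‖ ^ 2 := fun Y _ _ y => by
      exact inner_self_eq_norm_sq (𝕜 := ℂ) y
    rw [e] at this
    refine this.congr fun i => e _ _
  have := (Real.continuous_sqrt.tendsto _).comp h1
  rw [Real.sqrt_sq (norm_nonneg _)] at this
  refine this.congr fun i => ?_
  simp [Real.sqrt_sq (norm_nonneg _)]

theorem exists_lift (u : Ultrafilter ι) (q : bddFun ι H →ₗ[ℂ] X) (hd : DenseRange q)
    (hq : ∀ f g, Tendsto (fun i => inner ℂ (f.1 i) (g.1 i)) u (𝓝 (inner ℂ (q f) (q g))))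
    (T : H →L[ℂ] H) : ∃ S : X →L[ℂ] X, ∀ f, S (q f) = q (bddMap ι T f) := by
  refine ⟨(q.comp (bddMap ι T)).extendOfNorm q, fun f => ?_⟩
  refine LinearMap.extendOfNorm_eq hd ⟨‖T‖, fun f => ?_⟩ f
  exact le_of_tendsto_of_tendsto' (tendsto_norm_q u q hq (bddMap ι T f))
    ((tendsto_norm_q u q hq f).const_mul _) fun i => T.le_opNorm _

theorem lift_adj (u : Ultrafilter ι) (q : bddFun ι H →ₗ[ℂ] X) (hd : DenseRange q)
    (hq : ∀ f g, Tendsto (fun i => inner ℂ (f.1 i) (g.1 i)) u (𝓝 (inner ℂ (q f) (q g))))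
    (T T' : H →L[ℂ] H) (hT : ∀ x y, inner ℂ (T x) y = inner ℂ x (T' y))
    (S S' : X →L[ℂ] X) (hS : ∀ f, S (q f) = q (bddMap ι T f))
    (hS' : ∀ f, S' (q f) = q (bddMap ι T' f)) (x y : X) :
    inner ℂ (S x) y = inner ℂ x (S' y) := by
  refine hd.induction_on₂ (p := fun x y => inner ℂ (S x) y = inner ℂ x (S' y)) ?_ ?_ x y
  · exact isClosed_eq (by fun_prop) (by fun_prop)
  · intro f g
    rw [hS, hS']
    refine tendsto_nhds_unique (hq _ _) ((hq _ _).congr fun i => ?_)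
    exact (hT _ _).symm

end ultra

section gs

universe uu

variable {ι : Type uu} {H : Type uu} [NormedAddCommGroup H] [InnerProductSpace ℂ H]

theorem unif {Y : Type uu} [NormedAddCommGroup Y] [InnerProductSpace ℂ Y]
    (l : Filter ι) (F : Submodule ℂ Y) [FiniteDimensional ℂ F] (D : ι → Y →ₗ[ℂ] H)
    (hD : ∀ x ∈ F, Tendsto (fun i => ‖D i x‖) l (𝓝 0)) (ε : ℝ) (hε : 0 < ε) :
    ∀ᶠ i in l, ∀ x ∈ F, ‖D i x‖ ≤ ε * ‖x‖ := by
  let b := stdOrthonormalBasis ℂ F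
  let N := Module.finrank ℂ F
  have hN : (0 : ℝ) < N + 1 := by positivity
  have h1 : ∀ᶠ i in l, ∀ k, ‖D i (b k)‖ < ε / (N + 1) := by
    rw [eventually_all]
    intro k
    exact (hD _ (b k).2).eventually_lt_const (by positivity)
  filter_upwards [h1] with i hi x hx
  have e : x = ∑ k, inner ℂ (b k) (⟨x, hx⟩ : F) • (b k : Y) := by
    have := congrArg (Subtype.val) (b.sum_repr' ⟨x, hx⟩)
    simpa using this.symm
  conv_lhs => rw [e]
  rw [map_sum]
  refine (norm_sum_le _ _).trans ?_
  have : ∀ k ∈ Finset.univ, ‖D i (inner ℂ (b k) (⟨x, hx⟩ : F) • (b k : Y))‖ ≤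
      ‖x‖ * (ε / (N + 1)) := by
    intro k _
    rw [map_smul, norm_smul]
    refine mul_le_mul ?_ (hi k).le (norm_nonneg _) (norm_nonneg _)
    refine (norm_inner_le_norm _ _).trans ?_
    rw [b.orthonormal.1 k, one_mul]
    rfl
  refine (Finset.sum_le_sum this).trans ?_
  rw [Finset.sum_const, Finset.card_univ, Fintype.card_fin, nsmul_eq_mul]
  have h3 : (N : ℝ) * (‖x‖ * (ε / (N + 1))) = ε * ‖x‖ * (N / (N + 1)) := by
    field_simp
  change (N : ℝ) * (‖x‖ * (ε / (N + 1))) ≤ _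
  rw [h3]
  refine mul_le_of_le_one_right (by positivity) ?_
  rw [div_le_one hN]; linarith

theorem gs_perturb (l : Filter ι) (n : ℕ) (f : Fin n → ι → H)
    (hf : ∀ j k, Tendsto (fun i => inner ℂ (f j i) (f k i)) l (𝓝 (if j = k then 1 else 0))) :
    ∃ f' : Fin n → ι → H, (∀ᶠ i in l, Orthonormal ℂ (fun j => f' j i)) ∧
      (∀ j, Tendsto (fun i => ‖f' j i - f j i‖) l (𝓝 0)) ∧
      ∀ j i, f' j i ∈ Submodule.span ℂ (Set.range (fun j => f j i)) := by
  have hn : ∀ j, Tendsto (fun i => ‖f j i‖) l (𝓝 1) := by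
    intro j
    have h1 : Tendsto (fun i => ‖f j i‖ ^ 2) l (𝓝 1) := by
      have := (Complex.continuous_re.tendsto _).comp (hf j j)
      simp only [if_true, Complex.one_re] at this
      refine this.congr fun i => ?_
      exact inner_self_eq_norm_sq (𝕜 := ℂ) (f j i)
    have := (Real.continuous_sqrt.tendsto _).comp h1
    rw [Real.sqrt_one] at this
    refine this.congr fun i => ?_
    simp [Real.sqrt_sq (norm_nonneg _)]
  let g : Fin n → ι → H := fun j i => InnerProductSpace.gramSchmidt ℂ (fun j => f j i) j
  let f' : Fin n → ι → H := fun j i => InnerProductSpace.gramSchmidtNormed ℂ (fun j => f j i) j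
  have hf' : ∀ j i, f' j i = ((‖g j i‖ : ℂ))⁻¹ • g j i := fun j i => rfl
  have hf'1 : ∀ j i, ‖f' j i‖ ≤ 1 := by
    intro j i
    rw [hf', norm_smul, norm_inv, Complex.norm_real, norm_norm]
    exact inv_mul_le_one
  have hg : ∀ j i, g j i = f j i - ∑ k ∈ Finset.Iio j, inner ℂ (f' k i) (f j i) • f' k i := by
    intro j i
    simp only [g]
    rw [InnerProductSpace.gramSchmidt_def]
    congr 1
    refine Finset.sum_congr rfl fun k _ => ?_
    rw [Submodule.starProjection_singleton, hf']
    simp only [g]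
    rw [inner_smul_left, smul_smul, map_inv₀, Complex.conj_ofReal]
    congr 1
    simp only [Complex.coe_algebraMap, div_eq_mul_inv]
    push_cast
    ring
  have key : ∀ j, Tendsto (fun i => ‖f' j i - f j i‖) l (𝓝 0) ∧
      Tendsto (fun i => ‖g j i‖) l (𝓝 1) := by
    intro j
    induction j using WellFoundedLT.induction with
    | _ j ih =>
    have h1 : Tendsto (fun i => ‖g j i - f j i‖) l (𝓝 0) := by
      have hb : ∀ i, ‖g j i - f j i‖ ≤ ∑ k ∈ Finset.Iio j,
          (‖inner ℂ (f k i) (f j i)‖ + ‖f' k i - f k i‖ * ‖f j i‖) := by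
        intro i
        rw [hg, sub_sub_cancel_left, norm_neg]
        refine (norm_sum_le _ _).trans (Finset.sum_le_sum fun k _ => ?_)
        rw [norm_smul]
        refine (mul_le_of_le_one_right (norm_nonneg _) (hf'1 k i)).trans ?_
        have : inner ℂ (f' k i) (f j i) = inner ℂ (f k i) (f j i)
            + inner ℂ (f' k i - f k i) (f j i) := by
          rw [inner_sub_left]; ring
        rw [this]
        exact (norm_add_le _ _).trans (add_le_add le_rfl (norm_inner_le_norm _ _))
      refine squeeze_zero (fun i => norm_nonneg _) hb ?_
      rw [show (0 : ℝ) = ∑ k ∈ Finset.Iio j, 0 by simp]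
      refine tendsto_finsetSum _ fun k hk => ?_
      have hk' := Finset.mem_Iio.1 hk
      have a1 := (hf k j).norm
      rw [if_neg hk'.ne, norm_zero] at a1
      have a2 := ((ih k hk').1).mul (hn j)
      simpa using a1.add a2
    have h2 : Tendsto (fun i => ‖g j i‖ - ‖f j i‖) l (𝓝 0) :=
      squeeze_zero_norm (fun i => abs_norm_sub_norm_le _ _) h1
    have h3 : Tendsto (fun i => ‖g j i‖) l (𝓝 1) := by
      simpa using h2.add (hn j)
    refine ⟨?_, h3⟩
    have h4 : Tendsto (fun i => |1 - ‖g j i‖|) l (𝓝 0) := by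
      simpa using (h3.const_sub 1).abs
    have h5 := h4.add h1
    rw [add_zero] at h5
    refine squeeze_zero' (Eventually.of_forall fun i => norm_nonneg _) ?_ h5
    filter_upwards [h3.eventually_const_lt zero_lt_one] with i hi
    have e1 : f' j i - f j i = (((‖g j i‖ : ℂ))⁻¹ - 1) • g j i + (g j i - f j i) := by
      rw [hf', sub_smul, one_smul]; abel
    rw [e1]
    refine (norm_add_le _ _).trans (add_le_add (le_of_eq ?_) le_rfl)
    have e2 : ((‖g j i‖ : ℂ))⁻¹ - 1 = (((‖g j i‖)⁻¹ - 1 : ℝ) : ℂ) := by push_cast; rfl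
    rw [norm_smul, e2, Complex.norm_real, Real.norm_eq_abs]
    rw [← abs_of_pos hi, ← abs_mul, abs_of_pos hi, sub_mul, inv_mul_cancel₀ hi.ne', one_mul]
  refine ⟨f', ?_, fun j => (key j).1, fun j i => ?_⟩
  · have : ∀ᶠ i in l, ∀ j, 0 < ‖g j i‖ := by
      rw [eventually_all]
      intro j
      exact (key j).2.eventually_const_lt zero_lt_one
    filter_upwards [this] with i hi
    refine ⟨fun j => ?_, fun j k hjk => ?_⟩
    · change ‖f' j i‖ = 1
      rw [hf', norm_smul, norm_inv, Complex.norm_real, norm_norm, inv_mul_cancel₀ (hi j).ne']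
    · change inner ℂ (f' j i) (f' k i) = 0
      rw [hf', hf', inner_smul_left, inner_smul_right]
      have := InnerProductSpace.gramSchmidt_orthogonal ℂ (fun j => f j i) hjk
      simp only [g]
      rw [this, mul_zero, mul_zero]
  · rw [hf']
    refine Submodule.smul_mem _ _ ?_
    rw [← InnerProductSpace.span_gramSchmidt ℂ (fun j => f j i)]
    exact Submodule.subset_span ⟨j, rfl⟩

variable {X : Type uu} [NormedAddCommGroup X] [InnerProductSpace ℂ X]

def bddConst (ι : Type uu) (h : H) : bddFun ι H := ⟨fun _ => h, ‖h‖, fun _ => le_rfl⟩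

theorem approx (u : Ultrafilter ι) (q : bddFun ι H →ₗ[ℂ] X) [CompleteSpace X]
    (hq : ∀ f g, Tendsto (fun i => inner ℂ (f.1 i) (g.1 i)) u (𝓝 (inner ℂ (q f) (q g))))
    (F : Submodule ℂ X) [FiniteDimensional ℂ F] (hF : ∀ x ∈ F, ∃ f, q f = x)
    (hF' : ∀ x ∈ F, ∀ h : H, inner ℂ (q (bddConst ι h)) x = 0)
    (G : Submodule ℂ H) [FiniteDimensional ℂ G] :
    ∃ L : ι → X →L[ℂ] H, (∀ᶠ i in u, ∀ x ∈ F, ‖L i x‖ = ‖x‖) ∧ (∀ i x, L i x ∈ Gᗮ) ∧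
      ∀ g, q g ∈ F → Tendsto (fun i => ‖L i (q g) - g.1 i‖) u (𝓝 0) := by
  let e := stdOrthonormalBasis ℂ F
  have hex : ∀ j, ∃ f, q f = (e j : X) := fun j => hF _ (e j).2
  choose f0 hf0 using hex
  let P : H →L[ℂ] H := G.starProjection
  have hP0 : ∀ j, q (bddMap ι P (f0 j)) = 0 := by
    intro j
    have h1 := tendsto_norm_q u q hq (bddMap ι P (f0 j))
    have h2 : Tendsto (fun i => ‖(bddMap ι P (f0 j)).1 i‖) u (𝓝 0) := by
      let b := stdOrthonormalBasis ℂ G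
      have hb : ∀ i, ‖(bddMap ι P (f0 j)).1 i‖ ≤ ∑ k, ‖inner ℂ (b k : H) ((f0 j).1 i)‖ := by
        intro i
        have : (bddMap ι P (f0 j)).1 i = ∑ k, inner ℂ (b k : H) ((f0 j).1 i) • (b k : H) := by
          change G.starProjection ((f0 j).1 i) = _
          rw [Submodule.starProjection_apply, b.orthogonalProjectionOnto_apply_eq_sum]
          simp
        rw [this]
        refine (norm_sum_le _ _).trans (Finset.sum_le_sum fun k _ => ?_)
        rw [norm_smul]
        have : ‖(b k : H)‖ = 1 := b.orthonormal.1 k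
        rw [this, mul_one]
      refine squeeze_zero (fun i => norm_nonneg _) hb ?_
      rw [show (0 : ℝ) = ∑ k : Fin (Module.finrank ℂ G), 0 by simp]
      refine tendsto_finsetSum _ fun k _ => ?_
      have h3 := (hq (bddConst ι (b k : H)) (f0 j)).norm
      rw [hf0, hF' _ (e j).2, norm_zero] at h3
      exact h3
    exact norm_eq_zero.1 (tendsto_nhds_unique h1 h2)
  let f1 : Fin (Module.finrank ℂ F) → bddFun ι H := fun j => f0 j - bddMap ι P (f0 j)
  have hf1 : ∀ j, q (f1 j) = (e j : X) := fun j => by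
    rw [map_sub, hP0, sub_zero, hf0]
  have hf1G : ∀ j i, (f1 j).1 i ∈ Gᗮ := fun j i =>
    Submodule.sub_starProjection_mem_orthogonal (K := G) ((f0 j).1 i)
  obtain ⟨f', h1, h2, h3⟩ := gs_perturb (u : Filter ι) _ (fun j => (f1 j).1) (fun j k => by
    have := hq (f1 j) (f1 k)
    rw [hf1, hf1] at this
    have h4 := orthonormal_iff_ite.1 e.orthonormal j k
    rw [Submodule.coe_inner] at h4
    rwa [h4] at this)
  have hf'G : ∀ j i, f' j i ∈ Gᗮ := fun j i => by
    refine (Submodule.span_le.2 ?_) (h3 j i)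
    rintro _ ⟨k, rfl⟩
    exact hf1G k i
  let L : ι → X →L[ℂ] H := fun i => ∑ j, (innerSL ℂ (e j : X)).smulRight (f' j i)
  have hL : ∀ i x, L i x = ∑ j, inner ℂ (e j : X) x • f' j i := fun i x => by
    simp [L]
  have hexp : ∀ x ∈ F, x = ∑ j, inner ℂ (e j : X) x • (e j : X) := by
    intro x hx
    have := congrArg (Subtype.val) (e.sum_repr' ⟨x, hx⟩)
    simpa using this.symm
  refine ⟨L, ?_, fun i x => ?_, fun g hg => ?_⟩
  · filter_upwards [h1] with i hi x hx
    have e1 : ‖L i x‖ ^ 2 = ∑ j, ‖inner ℂ (e j : X) x‖ ^ 2 := by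
      rw [hL, ← inner_self_eq_norm_sq (𝕜 := ℂ), hi.inner_sum, map_sum]
      refine Finset.sum_congr rfl fun j _ => ?_
      rw [RCLike.conj_mul, ← RCLike.ofReal_pow, RCLike.ofReal_re]
    have e2 : ∑ j, ‖inner ℂ (e j : X) x‖ ^ 2 = ‖x‖ ^ 2 := by
      exact e.sum_sq_norm_inner_right ⟨x, hx⟩
    exact (sq_eq_sq₀ (norm_nonneg _) (norm_nonneg _)).1 (e1.trans e2)
  · rw [hL]
    exact Submodule.sum_mem _ fun j _ => Submodule.smul_mem _ _ (hf'G j i)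
  · let d : bddFun ι H := (∑ j, inner ℂ (e j : X) (q g) • f1 j) - g
    have hd : q d = 0 := by
      simp only [d, map_sub, map_sum, map_smul, hf1]
      rw [← hexp _ hg, sub_self]
    have hd' := tendsto_norm_q u q hq d
    rw [hd, norm_zero] at hd'
    have hb : ∀ i, ‖L i (q g) - g.1 i‖ ≤
        (∑ j, ‖inner ℂ (e j : X) (q g)‖ * ‖f' j i - (f1 j).1 i‖) + ‖d.1 i‖ := by
      intro i
      have e1 : L i (q g) - g.1 i =
          (∑ j, inner ℂ (e j : X) (q g) • (f' j i - (f1 j).1 i)) + d.1 i := by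
        have : d.1 i = (∑ j, inner ℂ (e j : X) (q g) • (f1 j).1 i) - g.1 i := by
          simp [d, Finset.sum_apply]
        rw [this, hL]
        simp only [smul_sub, Finset.sum_sub_distrib]
        abel
      rw [e1]
      refine (norm_add_le _ _).trans (add_le_add ((norm_sum_le _ _).trans
        (Finset.sum_le_sum fun j _ => ?_)) le_rfl)
      rw [norm_smul]
    refine squeeze_zero (fun i => norm_nonneg _) hb ?_
    have : Tendsto (fun i => ∑ j, ‖inner ℂ (e j : X) (q g)‖ * ‖f' j i - (f1 j).1 i‖) u (𝓝 0) := by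
      rw [show (0 : ℝ) = ∑ k : Fin (Module.finrank ℂ F), 0 by simp]
      refine tendsto_finsetSum _ fun k _ => ?_
      simpa using (h2 k).const_mul ‖inner ℂ (e k : X) (q g)‖
    simpa using this.add hd'

theorem approx2 (u : Ultrafilter ι) (q : bddFun ι H →ₗ[ℂ] X) [CompleteSpace X]
    (hq : ∀ f g, Tendsto (fun i => inner ℂ (f.1 i) (g.1 i)) u (𝓝 (inner ℂ (q f) (q g))))
    (F : Submodule ℂ X) [FiniteDimensional ℂ F] (hF : ∀ x ∈ F, ∃ f, q f = x)
    (hF' : ∀ x ∈ F, ∀ h : H, inner ℂ (q (bddConst ι h)) x = 0)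
    (G : Submodule ℂ H) [FiniteDimensional ℂ G]
    (T T' : H →L[ℂ] H) (S S' : X →L[ℂ] X) (hS : ∀ f, S (q f) = q (bddMap ι T f))
    (hS' : ∀ f, S' (q f) = q (bddMap ι T' f))
    (F0 : Submodule ℂ X) (h0 : F0 ≤ F) (h0S : ∀ x ∈ F0, S x ∈ F) (h0S' : ∀ x ∈ F0, S' x ∈ F)
    (ε : ℝ) (hε : 0 < ε) :
    ∃ L : X →L[ℂ] H, (∀ x ∈ F, ‖L x‖ = ‖x‖) ∧ (∀ x, L x ∈ Gᗮ) ∧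
      (∀ x ∈ F0, ‖T (L x) - L (S x)‖ ≤ ε * ‖x‖) ∧
      (∀ x ∈ F0, ‖T' (L x) - L (S' x)‖ ≤ ε * ‖x‖) := by
  obtain ⟨L, hL1, hL2, hL3⟩ := approx u q hq F hF hF' G
  have : FiniteDimensional ℂ F0 := Submodule.finiteDimensional_of_le h0
  have main : ∀ (A : H →L[ℂ] H) (R : X →L[ℂ] X), (∀ f, R (q f) = q (bddMap ι A f)) →
      (∀ x ∈ F0, R x ∈ F) → ∀ᶠ i in u, ∀ x ∈ F0, ‖A (L i x) - L i (R x)‖ ≤ ε * ‖x‖ := by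
    intro A R hR hRF
    refine unif (u : Filter ι) F0 (fun i => (A.comp (L i) - (L i).comp R : X →L[ℂ] H).toLinearMap)
      (fun x hx => ?_) ε hε
    obtain ⟨g, rfl⟩ := hF x (h0 hx)
    have t1 := (hL3 g (h0 hx)).const_mul ‖A‖
    have t2 := hL3 (bddMap ι A g) (hR g ▸ hRF _ hx)
    have t3 := t1.add t2
    rw [mul_zero, add_zero] at t3
    refine squeeze_zero (fun i => norm_nonneg _) (fun i => ?_) t3
    have e1 : (A.comp (L i) - (L i).comp R : X →L[ℂ] H).toLinearMap (q g) =
        A (L i (q g) - g.1 i) - (L i (q (bddMap ι A g)) - A (g.1 i)) := by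
      change A (L i (q g)) - L i (R (q g)) = _
      rw [hR, map_sub]; abel
    rw [e1]
    exact (norm_sub_le _ _).trans (add_le_add (A.le_opNorm _) le_rfl)
  obtain ⟨i, hi1, hi2, hi3⟩ := (hL1.and ((main T S hS h0S).and (main T' S' hS' h0S'))).exists
  exact ⟨L i, hi1, hL2 i, hi2, hi3⟩

end gs

section assembly

universe uu

variable {H : Type uu} [NormedAddCommGroup H] [InnerProductSpace ℂ H] [CompleteSpace H]

theorem final_step {K : Type uu} [NormedAddCommGroup K] [InnerProductSpace ℂ K]
    (T B : H →L[ℂ] H) (S : K →L[ℂ] K)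
    (hU : ∀ ε : ℝ, 0 < ε → ∃ U : WithLp 2 (H × K) ≃ₗᵢ[ℂ] H, ∀ h x,
      ‖T (U (WithLp.toLp 2 (h, x))) - U (WithLp.toLp 2 (T h, S x))‖
        ≤ ε * ‖(WithLp.toLp 2 (h, x) : WithLp 2 (H × K))‖)
    (Q : H →ₗ[ℂ] H) (R : H →ₗ[ℂ] K) (hQ : ∀ x, T (Q x) = Q (B x)) (hR : ∀ x, S (R x) = R (B x))
    (hQR : ∀ x, ‖x‖ ^ 2 = ‖Q x‖ ^ 2 + ‖R x‖ ^ 2) :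
    ∃ A ∈ closure (unitaryOrbit T), IsRestrictionOf B A := by
  let e := WithLp.prodContinuousLinearEquiv 2 ℂ H K
  let TS : WithLp 2 (H × K) →L[ℂ] WithLp 2 (H × K) :=
    (e.symm : (H × K) →L[ℂ] WithLp 2 (H × K)).comp
      ((T.prodMap S).comp (e : WithLp 2 (H × K) →L[ℂ] (H × K)))
  have hTS : ∀ h x, TS (WithLp.toLp 2 (h, x)) = WithLp.toLp 2 (T h, S x) := fun h x => rfl
  obtain ⟨U1, -⟩ := hU 1 one_pos
  have hconj : ∀ {H₁ : Type uu} {H₂ : Type uu} [NormedAddCommGroup H₁] [InnerProductSpace ℂ H₁]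
    [NormedAddCommGroup H₂] [InnerProductSpace ℂ H₂]
    (W : H₁ ≃ₗᵢ[ℂ] H₂) (T : H₁ →L[ℂ] H₁) (x : H₂), conjOp W T x = W (T (W.symm x)) :=
    fun W T x => rfl
  refine ⟨conjOp U1 TS, ?_, ?_⟩
  · rw [Metric.mem_closure_iff]
    intro ε hε
    obtain ⟨U, hU⟩ := hU (ε / 2) (by positivity)
    refine ⟨conjOp (U.symm.trans U1) T, ⟨_, rfl⟩, ?_⟩
    rw [dist_eq_norm]
    refine lt_of_le_of_lt (ContinuousLinearMap.opNorm_le_bound _ (by positivity : 0 ≤ ε / 2)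
      fun y => ?_) (half_lt_self hε)
    obtain ⟨w, rfl⟩ := U1.surjective y
    have e1 : (conjOp U1 TS - conjOp (U.symm.trans U1) T) (U1 w) =
        U1 (U.symm (U (TS w) - T (U w))) := by
      rw [ContinuousLinearMap.sub_apply, hconj, hconj]
      simp
    rw [e1, U1.norm_map, U.symm.norm_map, U1.norm_map, norm_sub_rev]
    exact hU w.fst w.snd
  · let Y0 : H →ₗ[ℂ] H :=
      { toFun := fun x => U1 (WithLp.toLp 2 (Q x, R x))
        map_add' := fun x y => by
          rw [← map_add, map_add, map_add]; rfl
        map_smul' := fun c x => by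
          rw [map_smul Q, map_smul R, RingHom.id_apply, ← map_smul U1]; rfl }
    let Y : H →ₗᵢ[ℂ] H := ⟨Y0, fun x => by
      change ‖U1 (WithLp.toLp 2 (Q x, R x))‖ = ‖x‖
      rw [U1.norm_map]
      refine (sq_eq_sq₀ (norm_nonneg _) (norm_nonneg _)).1 ?_
      rw [WithLp.prod_norm_sq_eq_of_L2, hQR x]
      rfl⟩
    have hY : ∀ x, Y x = U1 (WithLp.toLp 2 (Q x, R x)) := fun x => rfl
    have hAY : ∀ x, conjOp U1 TS (Y x) = Y (B x) := by
      intro x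
      rw [hconj, hY, hY, U1.symm_apply_apply, hTS, hQ, hR]
    refine ⟨LinearMap.range Y.toLinearMap, ?_, ?_, Y.equivRange, ?_⟩
    · exact Y.isometry.isClosedEmbedding.isClosed_range
    · rintro _ ⟨x, rfl⟩
      exact ⟨B x, (hAY x).symm⟩
    · ext z
      obtain ⟨x, rfl⟩ := Y.equivRange.surjective z
      rw [hconj, LinearIsometryEquiv.symm_apply_apply]
      exact hAY x

def chainF {X : Type uu} [NormedAddCommGroup X] [InnerProductSpace ℂ X]
    (S S' : X →L[ℂ] X) (r : ℕ → X) : ℕ → Submodule ℂ X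
  | 0 => ⊥
  | k + 1 => (chainF S S' r k ⊔ (chainF S S' r k).map S.toLinearMap) ⊔
      ((chainF S S' r k).map S'.toLinearMap ⊔ Submodule.span ℂ {r k})

theorem hard_core {ι : Type uu} [TopologicalSpace.SeparableSpace H]
    {X : Type uu} [NormedAddCommGroup X] [InnerProductSpace ℂ X] [CompleteSpace X]
    (u : Ultrafilter ι) (q : bddFun ι H →ₗ[ℂ] X)
    (hq : ∀ f g, Tendsto (fun i => inner ℂ (f.1 i) (g.1 i)) u (𝓝 (inner ℂ (q f) (q g))))
    (T T' B : H →L[ℂ] H) (hadjT : ∀ x y, inner ℂ (T x) y = inner ℂ x (T' y))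
    (S S' : X →L[ℂ] X) (hS : ∀ f, S (q f) = q (bddMap ι T f))
    (hS' : ∀ f, S' (q f) = q (bddMap ι T' f))
    (hadj : ∀ x y, inner ℂ (S x) y = inner ℂ x (S' y))
    (c V : H →ₗᵢ[ℂ] X) (hc : ∀ h, c h = q (bddConst ι h)) (hV : ∀ x, ∃ f, q f = V x)
    (hSV : ∀ x, S (V x) = V (B x)) :
    ∃ A ∈ closure (unitaryOrbit T), IsRestrictionOf B A := by
  have hadj' : ∀ x y, inner ℂ (S' x) y = inner ℂ x (S y) := fun x y => by
    rw [← inner_conj_symm, ← hadj, inner_conj_symm]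
  have hadjT' : ∀ x y, inner ℂ (T' x) y = inner ℂ x (T y) := fun x y => by
    rw [← inner_conj_symm, ← hadjT, inner_conj_symm]
  have hSc : ∀ h, S (c h) = c (T h) := fun h => by rw [hc, hS, hc]; rfl
  have hS'c : ∀ h, S' (c h) = c (T' h) := fun h => by rw [hc, hS', hc]; rfl
  let ca : X →L[ℂ] H := ContinuousLinearMap.adjoint c.toContinuousLinearMap
  have hca : ∀ h x, inner ℂ h (ca x) = inner ℂ (c h) x := fun h x =>
    ContinuousLinearMap.adjoint_inner_right _ _ _
  let Q : H →L[ℂ] H := ca.comp V.toContinuousLinearMap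
  have hQ : ∀ x, Q x = ca (V x) := fun x => rfl
  let R : H →L[ℂ] X := V.toContinuousLinearMap - c.toContinuousLinearMap.comp Q
  have hR : ∀ x, R x = V x - c (Q x) := fun x => rfl
  have hTQ : ∀ x, T (Q x) = Q (B x) := by
    intro x
    refine ext_inner_left ℂ fun h => ?_
    rw [hQ, hQ, hca, ← hadjT', hca, ← hS'c, hadj', hSV]
  have hSR : ∀ x, S (R x) = R (B x) := by
    intro x
    rw [hR, hR, map_sub, hSV, hSc, hTQ]
  have hRc : ∀ h x, inner ℂ (c h) (R x) = 0 := by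
    intro h x
    rw [hR, inner_sub_right, c.inner_map_map, hQ, hca, sub_self]
  have hQR : ∀ x, ‖x‖ ^ 2 = ‖Q x‖ ^ 2 + ‖R x‖ ^ 2 := by
    intro x
    have h1 := norm_add_sq_eq_norm_sq_add_norm_sq_of_inner_eq_zero _ _ (hRc (Q x) x)
    rw [hR, add_sub_cancel, V.norm_map, c.norm_map] at h1
    rw [hR]
    nlinarith [h1]
  let x : ℕ → H := TopologicalSpace.denseSeq H
  let F := chainF S S' (fun k => R (x k))
  have hFs : ∀ k, F (k+1) = (F k ⊔ (F k).map S.toLinearMap) ⊔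
      ((F k).map S'.toLinearMap ⊔ Submodule.span ℂ {R (x k)}) := fun k => rfl
  have hfd : ∀ k, FiniteDimensional ℂ (F k) := by
    intro k
    induction k with
    | zero => change FiniteDimensional ℂ (⊥ : Submodule ℂ X); infer_instance
    | succ k ih => rw [hFs]; infer_instance
  have hmono : Monotone F := monotone_nat_of_le_succ fun k =>
    le_sup_left.trans le_sup_left
  have hFS : ∀ k, ∀ y ∈ F k, S y ∈ F (k+1) := fun k y hy =>
    (le_sup_right.trans le_sup_left : (F k).map S.toLinearMap ≤ F (k+1))
      (Submodule.mem_map_of_mem hy)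
  have hFS' : ∀ k, ∀ y ∈ F k, S' y ∈ F (k+1) := fun k y hy =>
    (le_sup_left.trans le_sup_right : (F k).map S'.toLinearMap ≤ F (k+1))
      (Submodule.mem_map_of_mem hy)
  have hFR : ∀ k, R (x k) ∈ F (k+1) := fun k =>
    (le_sup_right.trans le_sup_right : Submodule.span ℂ {R (x k)} ≤ F (k+1))
      (Submodule.mem_span_singleton_self _)
  have hFle : ∀ (Z : Submodule ℂ X), (∀ y ∈ Z, S y ∈ Z) → (∀ y ∈ Z, S' y ∈ Z) →
      (∀ y, R y ∈ Z) → ∀ k, F k ≤ Z := by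
    intro Z h1 h2 h3 k
    induction k with
    | zero => exact bot_le
    | succ k ih =>
      rw [hFs]
      refine sup_le (sup_le ih ?_) (sup_le ?_ ?_)
      · rintro _ ⟨y, hy, rfl⟩; exact h1 y (ih hy)
      · rintro _ ⟨y, hy, rfl⟩; exact h2 y (ih hy)
      · rw [Submodule.span_singleton_le_iff_mem]; exact h3 _
  have hFq : ∀ k, ∀ y ∈ F k, ∃ f, q f = y := by
    intro k y hy
    refine hFle (LinearMap.range q) ?_ ?_ ?_ k hy
    · rintro _ ⟨f, rfl⟩; exact ⟨_, (hS f).symm⟩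
    · rintro _ ⟨f, rfl⟩; exact ⟨_, (hS' f).symm⟩
    · intro y
      obtain ⟨f, hf⟩ := hV y
      exact ⟨f - bddConst ι (Q y), by rw [map_sub, hf, ← hc, hR]⟩
  have hFc : ∀ k, ∀ y ∈ F k, ∀ h : H, inner ℂ (q (bddConst ι h)) y = 0 := by
    intro k y hy h
    rw [← hc]
    have := hFle (LinearMap.range c.toLinearMap)ᗮ ?_ ?_ ?_ k hy
    · exact (Submodule.mem_orthogonal _ _).1 this _ ⟨h, rfl⟩
    · intro y hy
      rw [Submodule.mem_orthogonal] at hy ⊢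
      rintro _ ⟨h, rfl⟩
      change inner ℂ (c h) _ = 0
      rw [← hadj', hS'c]; exact hy _ ⟨_, rfl⟩
    · intro y hy
      rw [Submodule.mem_orthogonal] at hy ⊢
      rintro _ ⟨h, rfl⟩
      change inner ℂ (c h) _ = 0
      rw [← hadj, hSc]; exact hy _ ⟨_, rfl⟩
    · intro y
      rw [Submodule.mem_orthogonal]
      rintro _ ⟨h, rfl⟩
      exact hRc h y
  let K : Submodule ℂ X := (⨆ k, F k).topologicalClosure
  have hKc : IsClosed (K : Set X) := Submodule.isClosed_topologicalClosure _
  have hFK : ∀ k, F k ≤ K := fun k => (le_iSup F k).trans (Submodule.le_topologicalClosure _)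
  have hKcs : CompleteSpace K := hKc.completeSpace_coe
  have hKinv : ∀ A : X →L[ℂ] X, (∀ k, ∀ y ∈ F k, A y ∈ F (k+1)) → ∀ y ∈ K, A y ∈ K := by
    intro A hA y hy
    refine map_mem_closure A.continuous hy ?_
    intro z hz
    obtain ⟨k, hk⟩ := (Submodule.mem_iSup_of_directed F hmono.directed_le).1 hz
    exact (le_iSup F (k+1)) (hA k z hk)
  have hKR : ∀ y, R y ∈ K := by
    intro y
    have hcl : IsClosed {y | R y ∈ K} := hKc.preimage R.continuous
    have : Set.range x ⊆ {y | R y ∈ K} := by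
      rintro _ ⟨k, rfl⟩; exact hFK _ (hFR k)
    exact (hcl.closure_subset_iff.2 this) (TopologicalSpace.denseRange_denseSeq H y)
  let SK : K →L[ℂ] K := opRestrict S K (hKinv S hFS)
  let SK' : K →L[ℂ] K := opRestrict S' K (hKinv S' hFS')
  have hSK : ∀ y, ((SK y : K) : X) = S y := fun y => rfl
  have hSK' : ∀ y, ((SK' y : K) : X) = S' y := fun y => rfl
  let FK : ℕ → Submodule ℂ K := fun k => (F k).comap K.subtype
  have hFKm : ∀ k (y : K), y ∈ FK k ↔ (y : X) ∈ F k := fun k y => Iff.rfl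
  have hfdK : ∀ k, FiniteDimensional ℂ (FK k) := fun k =>
    Module.Finite.equiv (Submodule.comapSubtypeEquivOfLe (hFK k)).symm
  have hdense : ⊤ ≤ (⨆ k, FK k).topologicalClosure := by
    intro y _
    change y ∈ closure _
    rw [closure_subtype]
    refine closure_mono ?_ y.2
    intro z hz
    obtain ⟨k, hk⟩ := (Submodule.mem_iSup_of_directed F hmono.directed_le).1 hz
    exact ⟨⟨z, hFK k hk⟩, (le_iSup FK k) hk, rfl⟩
  have hP : AppProp FK SK SK' T T' := by
    intro n G hG ε hε
    obtain ⟨L, l1, l2, l3, l4⟩ := approx2 u q hq (F (n+1)) (hFq _) (hFc _) G T T' S S' hS hS'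
      (F n) (hmono (Nat.le_succ n)) (hFS n) (hFS' n) ε hε
    exact ⟨L.comp K.subtypeL, fun y hy => l1 y hy, fun y _ => l2 y, fun y hy => l3 y hy,
      fun y hy => l4 y hy⟩
  refine final_step T B SK (fun ε hε => ?_) Q.toLinearMap (R.toLinearMap.codRestrict K hKR) hTQ
    (fun y => Subtype.ext (hSR y)) hQR
  refine exists_U' FK (fun a b hab y hy => hmono hab hy) ?_ hdense SK SK'
    (fun y z => hadj y z) (fun k y hy => hFS k y hy) (fun k y hy => hFS' k y hy) T T' hadjT hP ε hε
  rw [Submodule.eq_bot_iff]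
  intro y hy
  have : (y : X) ∈ (⊥ : Submodule ℂ X) := hy
  exact Subtype.ext ((Submodule.mem_bot ℂ).1 this)

theorem hard_dir [TopologicalSpace.SeparableSpace H] (T B : H →L[ℂ] H)
    (hB : B ∈ sotClosure (unitaryOrbit T)) :
    ∃ A ∈ closure (unitaryOrbit T), IsRestrictionOf B A := by
  classical
  obtain ⟨u, hu, hlim⟩ := (mem_sotClosure_iff _ _).1 hB
  have hex : ∀ A : H →L[ℂ] H, ∃ W : H ≃ₗᵢ[ℂ] H, A ∈ unitaryOrbit T → A = conjOp W T := by
    intro A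
    by_cases h : A ∈ unitaryOrbit T
    · obtain ⟨W, hW⟩ := h
      exact ⟨W, fun _ => hW⟩
    · exact ⟨LinearIsometryEquiv.refl ℂ H, fun h' => absurd h' h⟩
  choose W hW using hex
  obtain ⟨X, i1, i2, i3, q, hd, hq⟩ := exists_ultra (H := H) u
  let T' := ContinuousLinearMap.adjoint T
  have hadjT : ∀ x y, inner ℂ (T x) y = inner ℂ x (T' y) := fun x y =>
    (ContinuousLinearMap.adjoint_inner_right T x y).symm
  obtain ⟨S, hS⟩ := exists_lift u q hd hq T
  obtain ⟨S', hS'⟩ := exists_lift u q hd hq T'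
  have hadj := lift_adj u q hd hq T T' hadjT S S' hS hS'
  let mk : ((H →L[ℂ] H) → H →ₗᵢ[ℂ] H) → H →ₗ[ℂ] bddFun (H →L[ℂ] H) H := fun Z =>
    { toFun := fun x => ⟨fun i => Z i x, ‖x‖, fun i => ((Z i).norm_map x).le⟩
      map_add' := fun x y => by ext i; exact map_add (Z i) x y
      map_smul' := fun c x => by ext i; exact map_smul (Z i) c x }
  let iso : ((H →L[ℂ] H) → H →ₗᵢ[ℂ] H) → H →ₗᵢ[ℂ] X := fun Z =>
    ⟨q.comp (mk Z), fun x => by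
      have h1 := tendsto_norm_q u q hq (mk Z x)
      refine tendsto_nhds_unique h1 ?_
      have : (fun i => ‖(mk Z x).1 i‖) = fun _ => ‖x‖ := by
        funext i; exact (Z i).norm_map x
      rw [this]; exact tendsto_const_nhds⟩
  let Z : (H →L[ℂ] H) → H →ₗᵢ[ℂ] H := fun A => (W A).symm.toLinearIsometry
  refine hard_core u q hq T T' B hadjT S S' hS hS' hadj (iso fun _ => LinearIsometry.id) (iso Z)
    (fun h => rfl) (fun x => ⟨mk Z x, rfl⟩) (fun x => ?_)
  change S (q (mk Z x)) = q (mk Z (B x))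
  rw [hS, ← sub_eq_zero, ← map_sub, ← norm_eq_zero]
  refine tendsto_nhds_unique (tendsto_norm_q u q hq _) ?_
  have h1 : Tendsto (fun A : H →L[ℂ] H => ‖A x - B x‖) u (𝓝 0) := by
    have := ((hlim x).sub_const (B x)).norm
    rwa [sub_self, norm_zero] at this
  refine h1.congr' ?_
  filter_upwards [hu] with A hA
  change _ = ‖T ((W A).symm x) - (W A).symm (B x)‖
  rw [← (W A).norm_map (T ((W A).symm x) - (W A).symm (B x)), map_sub,
    LinearIsometryEquiv.apply_symm_apply]
  conv_lhs => rw [hW A hA]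
  rfl

end assembly
/-- **Theorem 3.7, SOT case.** The SOT closure of the unitary orbit of `T` is the
set of operators unitarily equivalent to restrictions of operators in the norm closure of the
unitary orbit of `T`. -/
theorem stmt15 {H : Type*} [NormedAddCommGroup H] [InnerProductSpace ℂ H] [CompleteSpace H]
    [TopologicalSpace.SeparableSpace H] (hinf : ¬ FiniteDimensional ℂ H)
    (T : H →L[ℂ] H) :
    sotClosure (unitaryOrbit T) =
      {B : H →L[ℂ] H | ∃ A ∈ closure (unitaryOrbit T), IsRestrictionOf B A} := by
  ext B
  constructor
  · intro hB
    exact hard_dir T B hB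
  · rintro ⟨A, hA, hBA⟩
    exact easy_dir T A B hA hBA
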